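/- arXiv:1611.02469 — 4 statements merged into one kernel-verified Lean document; each statement's English description precedes it below -/
import Mathlib

section
/- Let (R, 𝔪) be a commutative Noetherian local ring and A a ring with R[X] ⊆ A ⊆ R[X, X⁻¹]. Let P and Q be finitely generated projective A-modules and φ : Q → P an A-linear map. If φ is a split monomorphism modulo 𝔪A and φ_f is a split monomorphism for some special monic polynomial f ∈ R[X], then φ is a split monomorphism. -/
set_option synthInstance.maxHeartbeats 1000000
set_option maxHeartbeats 1000000
open Polynomial

/-- A polynomial is special monic if it is monic and has constant term `1`. -/
def IsSpecialMonic {R : Type*} [CommRing R] (f : R[X]) : Prop :=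
  f.Monic ∧ f.coeff 0 = 1

/-- The ideal of scalars `a` such that `a • id` factors through `φ`. -/
def factorIdeal {A Q P : Type*} [CommRing A] [AddCommGroup P] [Module A P]
    [AddCommGroup Q] [Module A Q] (φ : Q →ₗ[A] P) : Ideal A where
  carrier := {a | ∃ ψ : P →ₗ[A] Q, ψ ∘ₗ φ = a • LinearMap.id}
  zero_mem' := ⟨0, by simp⟩
  add_mem' := by
    rintro a b ⟨ψ, hψ⟩ ⟨χ, hχ⟩
    exact ⟨ψ + χ, by rw [LinearMap.add_comp, hψ, hχ, add_smul]⟩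
  smul_mem' := by
    rintro c a ⟨ψ, hψ⟩
    exact ⟨c • ψ, by rw [LinearMap.smul_comp, hψ, smul_smul, smul_eq_mul]⟩

lemma mem_factorIdeal {A Q P : Type*} [CommRing A] [AddCommGroup P] [Module A P]
    [AddCommGroup Q] [Module A Q] {φ : Q →ₗ[A] P} {a : A} :
    a ∈ factorIdeal φ ↔ ∃ ψ : P →ₗ[A] Q, ψ ∘ₗ φ = a • LinearMap.id :=
  Iff.rfl

/-- A map whose localization at `S` is a split monomorphism splits up to an element of `S`. -/
lemma exists_mem_factorIdeal_of_localized {A Q P : Type*} [CommRing A] [AddCommGroup P]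
    [Module A P] [AddCommGroup Q] [Module A Q] [Module.FinitePresentation A P] [Module.Finite A Q]
    (φ : Q →ₗ[A] P) (S : Submonoid A)
    (ψ' : LocalizedModule S P →ₗ[Localization S] LocalizedModule S Q)
    (h : ψ' ∘ₗ LocalizedModule.map S φ = LinearMap.id) :
    ∃ s ∈ S, s ∈ factorIdeal φ := by
  obtain ⟨χ, s, hχ⟩ := Module.FinitePresentation.exists_lift_of_isLocalizedModule S
    (LocalizedModule.mkLinearMap S Q)
    (ψ'.restrictScalars A ∘ₗ LocalizedModule.mkLinearMap S P)
  have key : LocalizedModule.mkLinearMap S Q ∘ₗ (χ ∘ₗ φ) =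
      LocalizedModule.mkLinearMap S Q ∘ₗ ((s : A) • LinearMap.id) := by
    ext q
    have h1 := LinearMap.congr_fun hχ (φ q)
    have h2 := LinearMap.congr_fun h (LocalizedModule.mkLinearMap S Q q)
    have h3 : LocalizedModule.map S φ (LocalizedModule.mkLinearMap S Q q) =
        LocalizedModule.mkLinearMap S P (φ q) := IsLocalizedModule.map_apply S _ _ φ q
    rw [LinearMap.comp_apply, h3, LinearMap.id_apply] at h2
    simp only [LinearMap.comp_apply, LinearMap.smul_apply, LinearMap.coe_restrictScalars,
      h2] at h1 ⊢
    rw [h1, LinearMap.id_apply, map_smul]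
    rfl
  obtain ⟨t, ht⟩ := Module.Finite.exists_smul_of_comp_eq_of_isLocalizedModule S
    (LocalizedModule.mkLinearMap S Q) _ _ key
  refine ⟨t * s, (t * s).2, (t : A) • χ, ?_⟩
  rw [LinearMap.smul_comp, mul_smul]
  exact ht

/-- If `φ` splits modulo `I`, some element of `1 + I` factors through `φ`. -/
lemma exists_one_sub_mem_factorIdeal {A Q P : Type*} [CommRing A] [AddCommGroup P] [Module A P]
    [Module.Projective A P] [AddCommGroup Q] [Module A Q] [Module.Finite A Q]
    (φ : Q →ₗ[A] P) (I : Ideal A) (ψ : P →ₗ[A] Q ⧸ (I • (⊤ : Submodule A Q)))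
    (h : ∀ q, ψ (φ q) = Submodule.Quotient.mk q) :
    ∃ a ∈ I, 1 - a ∈ factorIdeal φ := by
  obtain ⟨χ, hχ⟩ := Module.projective_lifting_property (I • (⊤ : Submodule A Q)).mkQ ψ
    (Submodule.mkQ_surjective _)
  obtain ⟨p, hp, -, hpI, hp0⟩ :=
    LinearMap.exists_monic_and_natDegree_eq_and_coeff_mem_pow_and_aeval_eq_zero A
      (LinearMap.id - χ ∘ₗ φ) I (by
        rintro _ ⟨q, rfl⟩
        rw [← Submodule.Quotient.mk_eq_zero]
        have := LinearMap.congr_fun hχ (φ q)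
        simp only [LinearMap.comp_apply, Submodule.mkQ_apply, h] at this
        simp [this])
  refine ⟨1 - p.eval 1, ?_, ?_⟩
  · rw [← Ideal.Quotient.eq_zero_iff_mem, map_sub, sub_eq_zero, map_one,
      eval_eq_sum_range, Finset.sum_range_succ, map_add, map_sum]
    rw [Finset.sum_eq_zero, hp.coeff_natDegree]
    · simp
    · intro i hi
      rw [Ideal.Quotient.eq_zero_iff_mem]
      exact I.mul_mem_right _ (Ideal.pow_le_self
        (Nat.sub_ne_zero_of_lt (Finset.mem_range.1 hi)) (hpI i))
  · obtain ⟨g, hg⟩ := X_sub_C_dvd_sub_C_eval (a := (1 : A)) (p := p)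
    have e := congrArg (aeval (LinearMap.id - χ ∘ₗ φ : Module.End A Q))
      ((mul_comm _ _).trans hg.symm)
    simp only [map_sub, map_mul, hp0, aeval_X, aeval_C, map_one] at e
    refine ⟨aeval (LinearMap.id - χ ∘ₗ φ : Module.End A Q) g ∘ₗ χ, ?_⟩
    ext q
    have e := LinearMap.congr_fun e q
    simp [Module.algebraMap_end_apply] at e
    simp [← e]

/-- Every element of the intermediate ring is a polynomial modulo a special monic one. -/
lemma surjective_quotient_of_isSpecialMonic {R : Type*} [CommRing R]
    (A : Subalgebra R (LaurentPolynomial R)) (hA : ∀ p : R[X], p.toLaurent ∈ A)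
    (J : Ideal A) (f : R[X]) (hf : f.coeff 0 = 1) (hfJ : (⟨f.toLaurent, hA f⟩ : A) ∈ J) :
    Function.Surjective ((Ideal.Quotient.mkₐ R J).comp
      ((toLaurentAlg (R := R)).codRestrict A hA)) := by
  set π := (Ideal.Quotient.mkₐ R J).comp ((toLaurentAlg (R := R)).codRestrict A hA)
  have hπf : π f = 0 := Ideal.Quotient.eq_zero_iff_mem.2 hfJ
  have hinv : π X * π (-f.divX) = 1 := by
    have := congrArg π (X_mul_divX_add f)
    rw [hf, hπf] at this
    simp only [map_add, map_mul, map_one] at this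
    rw [map_neg]
    linear_combination -this
  intro y
  obtain ⟨a, rfl⟩ := Ideal.Quotient.mk_surjective y
  obtain ⟨n, p, hp⟩ := LaurentPolynomial.exists_T_pow (a : LaurentPolynomial R)
  have hp' : π p = Ideal.Quotient.mk J a * π X ^ n := by
    rw [← map_pow]
    change Ideal.Quotient.mk J _ = Ideal.Quotient.mk J a * Ideal.Quotient.mk J _
    rw [← map_mul]
    congr 1
    ext1
    change p.toLaurent = a * (X ^ n : R[X]).toLaurent
    rw [hp, toLaurent_X_pow]
  refine ⟨p * (-f.divX) ^ n, ?_⟩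
  have hpow : π X ^ n * π (-f.divX) ^ n = 1 := by
    rw [← map_pow, ← map_pow, ← map_mul, ← mul_pow, map_pow, map_mul, hinv, one_pow]
  rw [map_mul, hp', map_pow, mul_assoc, hpow, mul_one]

lemma finite_quotient_of_isSpecialMonic {R : Type*} [CommRing R]
    (A : Subalgebra R (LaurentPolynomial R)) (hA : ∀ p : R[X], p.toLaurent ∈ A)
    (J : Ideal A) (f : R[X]) (hf : IsSpecialMonic f) (hfJ : (⟨f.toLaurent, hA f⟩ : A) ∈ J) :
    Module.Finite R (A ⧸ J) := by
  have := hf.1.finite_quotient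
  have hs := surjective_quotient_of_isSpecialMonic A hA J f hf.2 hfJ
  set π := (Ideal.Quotient.mkₐ R J).comp ((toLaurentAlg (R := R)).codRestrict A hA)
  have hker : ∀ p ∈ Ideal.span {f}, π p = 0 := by
    intro p hp
    obtain ⟨g, rfl⟩ := Ideal.mem_span_singleton.1 hp
    have hπf : π f = 0 := Ideal.Quotient.eq_zero_iff_mem.2 hfJ
    rw [map_mul, hπf, zero_mul]
  refine Module.Finite.of_surjective (Ideal.Quotient.liftₐ (Ideal.span {f}) π hker).toLinearMap ?_
  intro y
  obtain ⟨p, hp⟩ := hs y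
  exact ⟨Ideal.Quotient.mk _ p, hp⟩

lemma eq_top_of_one_sub_mem_of_finite_quotient {R A : Type*} [CommRing R] [IsLocalRing R]
    [CommRing A] [Algebra R A] (J : Ideal A) [Module.Finite R (A ⧸ J)] (a : A)
    (ha : a ∈ (IsLocalRing.maximalIdeal R).map (algebraMap R A)) (haJ : 1 - a ∈ J) : J = ⊤ := by
  have h1 : (1 : A ⧸ J) ∈ (IsLocalRing.maximalIdeal R).map (algebraMap R (A ⧸ J)) := by
    have : (1 : A ⧸ J) = Ideal.Quotient.mk J a := by
      rw [← sub_eq_zero, ← map_one (Ideal.Quotient.mk J), ← map_sub]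
      exact Ideal.Quotient.eq_zero_iff_mem.2 haJ
    rw [this, IsScalarTower.algebraMap_eq R A (A ⧸ J), ← Ideal.map_map]
    exact Ideal.mem_map_of_mem _ ha
  have h2 : (⊤ : Submodule R (A ⧸ J)) = ⊥ :=
    Submodule.eq_bot_of_le_smul_of_le_jacobson_bot (IsLocalRing.maximalIdeal R) ⊤
      Module.Finite.fg_top
      (by rw [Ideal.smul_top_eq_map, (Ideal.eq_top_iff_one _).2 h1]; exact fun _ _ => trivial)
      (IsLocalRing.maximalIdeal_le_jacobson _)
  rw [Ideal.eq_top_iff_one, ← Ideal.Quotient.eq_zero_iff_mem, ← Submodule.mem_bot R, ← h2]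
  trivial

/-- Let `(R, 𝔪)` be a commutative Noetherian local ring and let `A` be a ring with
`R[X] ⊆ A ⊆ R[X, X⁻¹]` (modelled as a subalgebra of the Laurent polynomial ring containing
the image of the polynomial ring).  Let `P`, `Q` be finitely generated projective
`A`-modules and `φ : Q → P` an `A`-linear map.  If `φ` is a split monomorphism modulo
`𝔪A` and `φ_f` is a split monomorphism for some special monic `f ∈ R[X]`, then `φ` is a
split monomorphism. -/
theorem split_mono_of_special_monic_localization
    (R : Type) [CommRing R] [IsNoetherianRing R] [IsLocalRing R]
    (A : Subalgebra R (LaurentPolynomial R))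
    (hA : ∀ p : R[X], p.toLaurent ∈ A)
    (P Q : Type) [AddCommGroup P] [Module A P] [Module.Finite A P] [Module.Projective A P]
    [AddCommGroup Q] [Module A Q] [Module.Finite A Q] [Module.Projective A Q]
    (φ : Q →ₗ[A] P)
    (hmod : ∃ ψ : P →ₗ[A] Q ⧸ ((IsLocalRing.maximalIdeal R).map (algebraMap R A) •
        (⊤ : Submodule A Q)),
      ∀ q : Q, ψ (φ q) = Submodule.Quotient.mk q)
    (f : R[X]) (hf : IsSpecialMonic f)
    (hloc : ∃ ψ' : LocalizedModule (Submonoid.powers (⟨f.toLaurent, hA f⟩ : A)) P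
          →ₗ[Localization (Submonoid.powers (⟨f.toLaurent, hA f⟩ : A))]
        LocalizedModule (Submonoid.powers (⟨f.toLaurent, hA f⟩ : A)) Q,
      ψ' ∘ₗ (LocalizedModule.map (Submonoid.powers (⟨f.toLaurent, hA f⟩ : A)) φ) =
        LinearMap.id) :
    ∃ ψ : P →ₗ[A] Q, ψ ∘ₗ φ = LinearMap.id := by
  have : Module.FinitePresentation A P := Module.finitePresentation_of_projective A P
  obtain ⟨ψ, hψ⟩ := hmod
  obtain ⟨a, ha, haJ⟩ := exists_one_sub_mem_factorIdeal φ _ ψ hψ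
  obtain ⟨ψ', hψ'⟩ := hloc
  obtain ⟨_, ⟨n, rfl⟩, hn⟩ := exists_mem_factorIdeal_of_localized φ _ ψ' hψ'
  have : Module.Finite R (A ⧸ factorIdeal φ) := by
    refine finite_quotient_of_isSpecialMonic A hA _ (f ^ n) ⟨hf.1.pow n, ?_⟩ ?_
    · rw [coeff_zero_eq_eval_zero, eval_pow, ← coeff_zero_eq_eval_zero, hf.2, one_pow]
    · convert hn using 1
      ext1
      simp
  have h1 := (Ideal.eq_top_iff_one _).1 (eq_top_of_one_sub_mem_of_finite_quotient _ a ha haJ)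
  simpa [mem_factorIdeal] using h1
end

section
/- Let (R, 𝔪) be a commutative Noetherian local ring and A a ring with R[X] ⊆ A ⊆ R[X, X⁻¹]. Let P, Q be finitely generated projective A-modules with rank(Q) < rank(P) (constant ranks). If Q_f is a direct summand of P_f for some special monic polynomial f ∈ R[X], then Q is a direct summand of P. -/
set_option synthInstance.maxHeartbeats 1000000
set_option maxHeartbeats 1000000

open Polynomial

/-- A module has constant rank `n` if its localization at every prime has rank `n`. -/
def HasConstRank (A : Type*) [CommRing A] (M : Type*) [AddCommGroup M] [Module A M]
    (n : ℕ) : Prop :=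
  ∀ (𝔭 : Ideal A) [𝔭.IsPrime],
    Module.finrank (Localization.AtPrime 𝔭) (LocalizedModule 𝔭.primeCompl M) = n

open TensorProduct

section General

variable {A : Type*} [CommRing A]

theorem exists_pow_smul_mem_of_finite {M N : Type*} [AddCommGroup M] [Module A M]
    [Module.Finite A M] [AddCommGroup N] [Module A N] (x : A) (h : M →ₗ[A] N) (S : Submodule A N)
    (H : ∀ m, ∃ n : ℕ, x ^ n • h m ∈ S) : ∃ n : ℕ, ∀ m, x ^ n • h m ∈ S := by
  obtain ⟨s, hs⟩ := Module.Finite.fg_top (R := A) (M := M)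
  choose n hn using H
  refine ⟨s.sup n, fun m ↦ ?_⟩
  have hle : (⊤ : Submodule A M) ≤ S.comap (x ^ s.sup n • h) := by
    rw [← hs, Submodule.span_le]
    intro y hy
    obtain ⟨c, hc⟩ := Nat.exists_eq_add_of_le (Finset.le_sup (f := n) hy)
    simp only [Submodule.comap_coe, Set.mem_preimage, LinearMap.smul_apply, SetLike.mem_coe]
    rw [hc, add_comm, pow_add, mul_smul]
    exact S.smul_mem _ (hn y)
  exact hle trivial

theorem exists_lift_pow_smul {M N N' : Type*} [AddCommGroup M] [Module A M] [Module.Finite A M]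
    [Module.Projective A M] [AddCommGroup N] [Module A N] [AddCommGroup N'] [Module A N'] (x : A)
    (i : N →ₗ[A] N') (hi : ∀ z, ∃ n : ℕ, x ^ n • z ∈ LinearMap.range i) (h : M →ₗ[A] N') :
    ∃ (n : ℕ) (H : M →ₗ[A] N), ∀ m, i (H m) = x ^ n • h m := by
  obtain ⟨n, hn⟩ := exists_pow_smul_mem_of_finite x h (LinearMap.range i) fun m ↦ hi (h m)
  obtain ⟨H, hH⟩ := Module.projective_lifting_property i.rangeRestrict
    ((x ^ n • h).codRestrict (LinearMap.range i) hn) i.surjective_rangeRestrict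
  exact ⟨n, H, fun m ↦ congrArg Subtype.val (LinearMap.congr_fun hH m)⟩

theorem exists_mul_sub_eq_algebraMap_eval {E : Type*} [Ring E] [Algebra A E] {W : E} {χ : A[X]}
    (hχ : aeval W χ = 0) (a : A) :
    ∃ V : E, V * (algebraMap A E a - W) = algebraMap A E (χ.eval a) := by
  obtain ⟨r, hr⟩ := X_sub_C_dvd_sub_C_eval (a := a) (p := χ)
  refine ⟨aeval W r, ?_⟩
  have h := congrArg (aeval W) hr
  rw [mul_comm] at h
  simp only [map_sub, map_mul, hχ, aeval_X, aeval_C, zero_sub] at h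
  rw [← neg_sub W, mul_neg, ← h, neg_neg]

theorem exists_comp_eq_smul_add {P Q : Type*} [AddCommGroup P] [Module A P] [AddCommGroup Q]
    [Module A Q] [Module.Finite A Q] {I : Ideal A} {φ : Q →ₗ[A] P} {ρ : P →ₗ[A] Q} {a : A}
    (h : ∀ z, ρ (φ z) - a • z ∈ I • (⊤ : Submodule A Q)) :
    ∃ (n : ℕ) (μ : A) (ρ' : P →ₗ[A] Q), μ ∈ I ∧ ρ' ∘ₗ φ = (a ^ n + μ) • LinearMap.id := by
  let ε : Module.End A Q := algebraMap A _ a - ρ ∘ₗ φ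
  have hε : LinearMap.range ε ≤ I • ⊤ := by
    rintro _ ⟨z, rfl⟩
    simpa [ε] using neg_mem (h z)
  obtain ⟨χ, hmonic, -, hcoeff, hχ⟩ :=
    LinearMap.exists_monic_and_natDegree_eq_and_coeff_mem_pow_and_aeval_eq_zero A ε I hε
  obtain ⟨V, hV⟩ := exists_mul_sub_eq_algebraMap_eval hχ a
  refine ⟨χ.natDegree, χ.eval a - a ^ χ.natDegree, V ∘ₗ ρ, ?_, ?_⟩
  · rw [eval_eq_sum_range, Finset.sum_range_succ, hmonic.coeff_natDegree, one_mul, add_sub_cancel_right]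
    refine Ideal.sum_mem _ fun i hi ↦ I.mul_mem_right _ ?_
    exact Ideal.pow_le_self (by have := Finset.mem_range.1 hi; omega) (hcoeff i)
  · rw [add_sub_cancel]
    ext z
    simpa [ε] using LinearMap.congr_fun hV z

end General

theorem exists_forall_leftInverse_smul_add_smul {K V W : Type*} [CommRing K] [IsDomain K]
    [IsPrincipalIdealRing K] [AddCommGroup V] [Module K V] [Module.Finite K V] [Module.Free K V]
    [AddCommGroup W] [Module K W] [Module.Finite K W] [Module.Free K W] {φ : V →ₗ[K] W}
    (hφ : Function.Injective φ) (hrank : Module.finrank K V < Module.finrank K W) :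
    ∃ θ : V →ₗ[K] W, ∀ a u : K, IsUnit u →
      ∃ ρ : W →ₗ[K] V, ρ ∘ₗ (a • φ + u • θ) = LinearMap.id := by
  classical
  obtain ⟨n, S⟩ := Submodule.smithNormalForm (Module.Free.chooseBasis K W) (LinearMap.range φ)
  let bV : Module.Basis (Fin n) K V := S.bN.map (LinearEquiv.ofInjective φ hφ).symm
  have hbV (i) : φ (bV i) = S.a i • S.bM (S.f i) := by
    rw [← S.snf]
    exact congrArg Subtype.val ((LinearEquiv.ofInjective φ hφ).apply_symm_apply (S.bN i))
  obtain ⟨j₀, hj₀⟩ : ∃ j, j ∉ Set.range S.f := by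
    by_contra! h
    have := Fintype.card_le_of_surjective S.f h
    rw [Module.finrank_eq_card_basis bV, Module.finrank_eq_card_basis S.bM] at hrank
    omega
  let s (i : Fin n) : Module.Free.ChooseBasisIndex K W :=
    if h : i.1 + 1 < n then S.f ⟨i.1 + 1, h⟩ else j₀
  have hs : Function.Injective s := by
    intro i j hij
    simp only [s] at hij
    split_ifs at hij with h1 h2 h2
    · have := S.f.injective hij
      simp only [Fin.mk.injEq] at this
      exact Fin.ext (by omega)
    · exact (hj₀ ⟨_, hij⟩).elim
    · exact (hj₀ ⟨_, hij.symm⟩).elim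
    · exact Fin.ext (by omega)
  refine ⟨bV.constr K fun i ↦ S.bM (s i), fun a u hu ↦ ?_⟩
  set θ := bV.constr K fun i ↦ S.bM (s i) with hθ
  let π : W →ₗ[K] V := S.bM.constr K (Function.extend s bV 0)
  have hπs (i) : π (S.bM (s i)) = bV i := by simp [π, hs.extend_apply]
  let E : Module.End K V := π ∘ₗ (a • φ + u • θ)
  have hE (i) : E (bV i) = (a * S.a i) • π (S.bM (S.f i)) + u • bV i := by
    simp [E, hbV, hθ, hπs, mul_smul]
  have hrange : ∀ m (hm : m < n), bV ⟨m, hm⟩ ∈ LinearMap.range E := by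
    intro m
    induction m with
    | zero =>
      intro hm
      have h0 : π (S.bM (S.f ⟨0, hm⟩)) = 0 := by
        have : ¬ ∃ i, s i = S.f ⟨0, hm⟩ := by
          rintro ⟨i, hi⟩
          simp only [s] at hi
          split_ifs at hi with h
          · simpa using S.f.injective hi
          · exact hj₀ ⟨_, hi.symm⟩
        simp [π, Function.extend_apply' _ _ _ this]
      have h := hE ⟨0, hm⟩
      rw [h0, smul_zero, zero_add] at h
      exact (Submodule.smul_mem_iff_of_isUnit _ hu).1 (h ▸ LinearMap.mem_range_self E _)
    | succ m ih =>
      intro hm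
      have h1 : π (S.bM (S.f ⟨m + 1, hm⟩)) = bV ⟨m, by omega⟩ := by
        rw [← hπs]
        simp [s, hm]
      have h := hE ⟨m + 1, hm⟩
      rw [h1, ← sub_eq_iff_eq_add'] at h
      refine (Submodule.smul_mem_iff_of_isUnit _ hu).1 (h ▸ ?_)
      exact sub_mem (LinearMap.mem_range_self E _) (Submodule.smul_mem _ _ (ih _))
  have hsurj : Function.Surjective E := by
    rw [← LinearMap.range_eq_top, eq_top_iff, ← bV.span_eq, Submodule.span_le]
    rintro _ ⟨i, rfl⟩
    exact hrange i i.2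
  have hbij : Function.Bijective E :=
    ⟨OrzechProperty.injective_of_surjective_endomorphism E hsurj, hsurj⟩
  refine ⟨(LinearEquiv.ofBijective E hbij).symm.toLinearMap ∘ₗ π, ?_⟩
  ext z
  exact (LinearEquiv.ofBijective E hbij).symm_apply_apply z

section BaseChange

variable {A K : Type*} [CommRing A] [CommRing K] [Algebra A K] {x : A}

theorem exists_pow_smul_mem_range_mk (hlift : ∀ c : K, ∃ n : ℕ, x ^ n • c ∈ (algebraMap A K).range)
    {N : Type*} [AddCommGroup N] [Module A N] (z : K ⊗[A] N) :
    ∃ n : ℕ, x ^ n • z ∈ LinearMap.range (TensorProduct.mk A K N 1) := by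
  induction z with
  | zero => exact ⟨0, by simp⟩
  | tmul c m =>
    obtain ⟨n, a, ha⟩ := hlift c
    refine ⟨n, a • m, ?_⟩
    rw [TensorProduct.smul_tmul', ← ha, Algebra.algebraMap_eq_smul_one, TensorProduct.mk_apply,
      TensorProduct.tmul_smul, TensorProduct.smul_tmul']
  | add y z hy hz =>
    obtain ⟨n, hn⟩ := hy
    obtain ⟨m, hm⟩ := hz
    refine ⟨n + m, ?_⟩
    rw [smul_add]
    refine add_mem ?_ ?_
    · rw [add_comm, pow_add, mul_smul]
      exact Submodule.smul_mem _ _ hn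
    · rw [pow_add, mul_smul]
      exact Submodule.smul_mem _ _ hm

theorem exists_pow_smul_mem_smul_top {I : Ideal A}
    (hker : ∀ a : A, algebraMap A K a = 0 → ∃ n : ℕ, x ^ n * a ∈ I)
    {N : Type*} [AddCommGroup N] [Module A N] [Module.Finite A N] [Module.Projective A N]
    (m : N) (hm : (1 : K) ⊗ₜ[A] m = 0) : ∃ n : ℕ, x ^ n • m ∈ I • (⊤ : Submodule A N) := by
  obtain ⟨d, f, g, -, -, hfg⟩ := Module.Finite.exists_comp_eq_id_of_projective A N
  have hg (i : Fin d) : ∃ n : ℕ, x ^ n * g m i ∈ I := by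
    refine hker _ ?_
    have h := congrArg ((TensorProduct.rid A K).toLinearMap ∘ₗ LinearMap.lTensor K (LinearMap.proj i ∘ₗ g)) hm
    simpa [Algebra.smul_def] using h
  choose n hn using hg
  refine ⟨∑ i, n i, ?_⟩
  have hmem : f (x ^ (∑ i, n i) • g m) ∈ I • (⊤ : Submodule A N) := by
    rw [← (Pi.basisFun A (Fin d)).sum_repr (x ^ (∑ i, n i) • g m), map_sum]
    refine Submodule.sum_mem _ fun i _ ↦ ?_
    rw [map_smul]
    refine Submodule.smul_mem_smul ?_ trivial
    obtain ⟨c, hc⟩ := Nat.exists_eq_add_of_le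
      (Finset.single_le_sum (f := n) (fun _ _ ↦ Nat.zero_le _) (Finset.mem_univ i))
    rw [hc]
    simp only [Pi.basisFun_repr, Pi.smul_apply, smul_eq_mul]
    rw [add_comm, pow_add, mul_assoc]
    exact I.mul_mem_left _ (hn i)
  rwa [map_smul, ← LinearMap.comp_apply, hfg] at hmem

theorem exists_forall_comp_eq_pow_add_smul [IsDomain K] [IsPrincipalIdealRing K] {I : Ideal A}
    (hx : IsUnit (algebraMap A K x))
    (hlift : ∀ c : K, ∃ n : ℕ, x ^ n • c ∈ (algebraMap A K).range)
    (hker : ∀ a : A, algebraMap A K a = 0 → ∃ n : ℕ, x ^ n * a ∈ I)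
    {P Q : Type*} [AddCommGroup P] [Module A P] [Module.Finite A P] [Module.Projective A P]
    [AddCommGroup Q] [Module A Q] [Module.Finite A Q] [Module.Projective A Q]
    (hrank : Module.finrank K (K ⊗[A] Q) < Module.finrank K (K ⊗[A] P))
    {φ : Q →ₗ[A] P} {ψ : P →ₗ[A] Q} {F : A} (hF : algebraMap A K F ≠ 0)
    (hψφ : ψ ∘ₗ φ = F • LinearMap.id) :
    ∃ θ : Q →ₗ[A] P, ∀ (a : A) (k : ℕ), ∃ (l : ℕ) (μ : A) (ρ : P →ₗ[A] Q), μ ∈ I ∧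
      ρ ∘ₗ (a • φ + x ^ k • θ) = (x ^ l + μ) • LinearMap.id := by
  have hinj : Function.Injective (φ.baseChange K) := by
    rw [injective_iff_map_eq_zero]
    intro z hz
    have h := congrArg (fun h : Q →ₗ[A] Q ↦ h.baseChange K z) hψφ
    simp only [LinearMap.baseChange_comp, LinearMap.comp_apply, hz, map_zero,
      LinearMap.baseChange_smul, LinearMap.baseChange_id, LinearMap.smul_apply,
      LinearMap.id_apply] at h
    rw [← algebraMap_smul K F z] at h
    exact (smul_eq_zero.1 h.symm).resolve_left hF
  obtain ⟨θ', hθ'⟩ := exists_forall_leftInverse_smul_add_smul hinj hrank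
  obtain ⟨j, θ, hθ⟩ := exists_lift_pow_smul x (TensorProduct.mk A K P 1)
    (exists_pow_smul_mem_range_mk hlift) (θ'.restrictScalars A ∘ₗ TensorProduct.mk A K Q 1)
  refine ⟨θ, fun a k ↦ ?_⟩
  obtain ⟨ρ', hρ'⟩ := hθ' (algebraMap A K a) (algebraMap A K x ^ (k + j)) (hx.pow _)
  obtain ⟨i, ρ, hρ⟩ := exists_lift_pow_smul x (TensorProduct.mk A K Q 1)
    (exists_pow_smul_mem_range_mk hlift) (ρ'.restrictScalars A ∘ₗ TensorProduct.mk A K P 1)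
  let φ' : Q →ₗ[A] P := a • φ + x ^ k • θ
  have hφ' (z : Q) : (1 : K) ⊗ₜ[A] φ' z =
      (algebraMap A K a • φ.baseChange K + algebraMap A K x ^ (k + j) • θ') (1 ⊗ₜ z) := by
    have := hθ z
    simp only [TensorProduct.mk_apply, LinearMap.comp_apply, LinearMap.restrictScalars_apply] at this
    simp only [φ', LinearMap.add_apply, LinearMap.smul_apply, TensorProduct.tmul_add,
      TensorProduct.tmul_smul, this, LinearMap.baseChange_tmul, ← map_pow, algebraMap_smul,
      pow_add, mul_smul]
  have hzero (z : Q) : (1 : K) ⊗ₜ[A] (ρ (φ' z) - x ^ i • z) = 0 := by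
    have h1 := hρ (φ' z)
    simp only [TensorProduct.mk_apply, LinearMap.comp_apply, LinearMap.restrictScalars_apply,
      hφ'] at h1
    replace h1 := h1.trans (congrArg (x ^ i • ·) (LinearMap.congr_fun hρ' _))
    simp only [LinearMap.id_apply] at h1
    rw [TensorProduct.tmul_sub, h1, TensorProduct.tmul_smul, sub_self]
  obtain ⟨n, hn⟩ := exists_pow_smul_mem_of_finite x (ρ ∘ₗ φ' - x ^ i • LinearMap.id)
    (I • (⊤ : Submodule A Q)) fun z ↦ exists_pow_smul_mem_smul_top hker _ (hzero z)
  obtain ⟨l, μ, ρ₁, hμ, h⟩ := exists_comp_eq_smul_add (I := I) (φ := φ') (ρ := x ^ n • ρ)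
    (a := x ^ (n + i)) (fun z ↦ by simpa [smul_sub, pow_add, mul_smul] using hn z)
  exact ⟨(n + i) * l, μ, ρ₁, hμ, by rw [h, pow_mul]⟩

end BaseChange

theorem finrank_tensorProduct_of_rankAtStalk_eq {A K M : Type*} [CommRing A] [CommRing K]
    [IsDomain K] [Algebra A K] [AddCommGroup M] [Module A M] [Module.Finite A M]
    [Module.Projective A M] [Module.Free K (K ⊗[A] M)] {n : ℕ}
    (h : Module.rankAtStalk (R := A) M = n) : Module.finrank K (K ⊗[A] M) = n := by
  have h1 := Module.rankAtStalk_baseChange (R := A) (M := M) (⊥ : PrimeSpectrum K)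
  rw [h, Module.rankAtStalk_eq_finrank_of_free] at h1
  simpa using h1
theorem LaurentPolynomial.isPrincipalIdealRing (k : Type*) [Field k] :
    IsPrincipalIdealRing (LaurentPolynomial k) where
  principal I := by
    rw [← IsLocalization.map_under (Submonoid.powers (X : k[X])) (LaurentPolynomial k) I]
    obtain ⟨a, ha⟩ := IsPrincipalIdealRing.principal (I.under k[X])
    refine ⟨algebraMap _ _ a, ?_⟩
    rw [ha, Ideal.submodule_span_eq, Ideal.map_span, Set.image_singleton, Ideal.submodule_span_eq]

theorem LaurentPolynomial.mapRingHom_toLaurent {R S : Type*} [CommRing R] [CommRing S]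
    (f : R →+* S) (p : R[X]) :
    AddMonoidAlgebra.mapRingHom ℤ f (toLaurent p) = toLaurent (p.map f) := by
  induction p using Polynomial.induction_on' with
  | add p q hp hq => simp [hp, hq]
  | monomial n a =>
    simp only [← C_mul_X_pow_eq_monomial, toLaurent_C_mul_X_pow, Polynomial.map_mul, map_C,
      Polynomial.map_pow, map_X]
    rw [← LaurentPolynomial.single_eq_C_mul_T, ← LaurentPolynomial.single_eq_C_mul_T,
      AddMonoidAlgebra.mapRingHom_single]

section SpecialMonic

variable {R : Type*} [CommRing R]

theorem IsSpecialMonic.mul {f g : R[X]} (hf : IsSpecialMonic f) (hg : IsSpecialMonic g) :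
    IsSpecialMonic (f * g) :=
  ⟨hf.1.mul hg.1, by rw [mul_coeff_zero, hf.2, hg.2, one_mul]⟩

theorem IsSpecialMonic.pow {f : R[X]} (hf : IsSpecialMonic f) (n : ℕ) : IsSpecialMonic (f ^ n) :=
  ⟨hf.1.pow n, by
    rw [coeff_zero_eq_eval_zero, eval_pow, ← coeff_zero_eq_eval_zero, hf.2, one_pow]⟩

theorem isSpecialMonic_X_add_one [Nontrivial R] : IsSpecialMonic (X + 1 : R[X]) :=
  ⟨monic_X_add_C (1 : R), by simp⟩

theorem IsSpecialMonic.isCoprime_X {g : R[X]} (hg : IsSpecialMonic g) : IsCoprime g X := by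
  refine ⟨1, -g.divX, ?_⟩
  have h := divX_mul_X_add g
  rw [hg.2, map_one] at h
  linear_combination -h

theorem exists_isSpecialMonic_eval_scaleRoots [Nontrivial R] {f : R[X]} (hf : IsSpecialMonic f)
    (hdeg : 0 < f.natDegree) {χ : (LaurentPolynomial R)[X]} (hχ : χ.Monic) :
    ∃ (k N : ℕ) (g : R[X]), IsSpecialMonic g ∧
      (χ.scaleRoots (toLaurent X ^ k)).eval (toLaurent f ^ (N + 1)) = toLaurent g := by
  choose m h hh using fun c : LaurentPolynomial R ↦ c.exists_T_pow
  set n := χ.natDegree with hn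
  set k := 1 + ∑ i ∈ Finset.range n, m (χ.coeff i)
  have hlift : ∀ i, ∃ h' : R[X], i < n →
      toLaurent (X * h') = χ.coeff i * (toLaurent X ^ k) ^ (n - i) := by
    intro i
    refine ⟨h (χ.coeff i) * X ^ (k * (n - i) - m (χ.coeff i) - 1), fun hi ↦ ?_⟩
    have h1 : m (χ.coeff i) ≤ ∑ i ∈ Finset.range n, m (χ.coeff i) :=
      Finset.single_le_sum (f := fun i ↦ m (χ.coeff i)) (fun _ _ ↦ Nat.zero_le _)
        (Finset.mem_range.2 hi)
    have h2 : k ≤ k * (n - i) := Nat.le_mul_of_pos_right _ (by omega)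
    have h3 : k * (n - i) =
        m (χ.coeff i) + (1 + (k * (n - i) - m (χ.coeff i) - 1)) := by omega
    rw [← pow_mul]
    conv_rhs => rw [h3]
    rw [pow_add, ← mul_assoc (χ.coeff i), ← map_pow toLaurent X (m _), toLaurent_X_pow, ← hh (χ.coeff i),
      ← map_pow, ← map_mul]
    congr 1
    ring
  choose h' hh' using hlift
  set N := ∑ i ∈ Finset.range n, (X * h' i).natDegree
  refine ⟨k, N, f ^ ((N + 1) * n) + ∑ i ∈ Finset.range n, X * h' i * f ^ ((N + 1) * i),
    ⟨?_, ?_⟩, ?_⟩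
  · refine (hf.1.pow _).add_of_left ?_
    rcases eq_or_ne n 0 with h0 | h0
    · rw [h0, Finset.range_zero, Finset.sum_empty, degree_zero]
      exact bot_lt_iff_ne_bot.2 (degree_ne_bot.2 (hf.1.pow _).ne_zero)
    rw [degree_eq_natDegree (hf.1.pow _).ne_zero, hf.1.natDegree_pow]
    refine lt_of_le_of_lt (degree_sum_le _ _) ?_
    rw [Finset.sup_lt_iff (WithBot.bot_lt_coe _)]
    intro i hi
    refine lt_of_le_of_lt degree_le_natDegree ?_
    rw [Nat.cast_lt]
    refine lt_of_le_of_lt natDegree_mul_le ?_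
    rw [hf.1.natDegree_pow]
    have h1 : (X * h' i).natDegree ≤ N :=
      Finset.single_le_sum (f := fun i ↦ (X * h' i).natDegree) (fun _ _ ↦ Nat.zero_le _) hi
    have h2 : i + 1 ≤ n := Finset.mem_range.1 hi
    calc _ < (N + 1) * f.natDegree + (N + 1) * i * f.natDegree := by nlinarith
      _ = (N + 1) * (i + 1) * f.natDegree := by ring
      _ ≤ _ := by gcongr
  · have h1 : eval 0 f = 1 := by rw [← coeff_zero_eq_eval_zero, hf.2]
    simp [coeff_zero_eq_eval_zero, eval_finsetSum, h1]
  · rw [eval_eq_sum_range, natDegree_scaleRoots, ← hn, Finset.sum_range_succ, coeff_scaleRoots,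
      ← hn, Nat.sub_self, pow_zero, mul_one, hχ.coeff_natDegree, one_mul, map_add, add_comm,
      map_sum, map_pow, pow_mul]
    congr 1
    refine Finset.sum_congr rfl fun i hi ↦ ?_
    rw [coeff_scaleRoots, ← hn, ← hh' i (Finset.mem_range.1 hi), map_mul _ (X * h' i), map_pow,
      pow_mul]

end SpecialMonic

/-- The inclusion of `R[X]` in a subalgebra of `R[X, X⁻¹]` containing it. -/
noncomputable def toLaurentSubalgebra {R : Type*} [CommRing R]
    {A : Subalgebra R (LaurentPolynomial R)} (hA : ∀ p : R[X], p.toLaurent ∈ A) : R[X] →ₐ[R] A :=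
  toLaurentAlg.codRestrict A hA

section Subalgebra

variable {R : Type*} [CommRing R] {A : Subalgebra R (LaurentPolynomial R)}
  (hA : ∀ p : R[X], p.toLaurent ∈ A)

theorem exists_toLaurentSubalgebra_eq_pow_mul (a : A) :
    ∃ (n : ℕ) (h : R[X]), toLaurentSubalgebra hA h = toLaurentSubalgebra hA X ^ n * a := by
  obtain ⟨n, h, hh⟩ := a.1.exists_T_pow
  refine ⟨n, h, Subtype.ext ?_⟩
  have : toLaurent h = toLaurent X ^ n * a.1 := by
    rw [hh, ← map_pow, toLaurent_X_pow, mul_comm]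
  exact this

theorem eq_top_of_isSpecialMonic_mem [IsLocalRing R] {J : Ideal A} {g : R[X]}
    (hg : IsSpecialMonic g) (hgJ : toLaurentSubalgebra hA g ∈ J) {l : ℕ} {μ : A}
    (hμ : μ ∈ (IsLocalRing.maximalIdeal R).map (algebraMap R A))
    (hJ : toLaurentSubalgebra hA X ^ l + μ ∈ J) : J = ⊤ := by
  by_contra hne
  obtain ⟨𝔫, hmax, hle⟩ := J.exists_le_maximal hne
  have hprime := hmax.isPrime
  let π := toLaurentSubalgebra hA
  let σ : R[X] →ₐ[R] A ⧸ 𝔫 := (Ideal.Quotient.mkₐ R 𝔫).comp π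
  have hσg : σ g = 0 := Ideal.Quotient.eq_zero_iff_mem.2 (hle hgJ)
  have hX : IsIntegral R (σ X) := by
    refine ⟨g, hg.1, ?_⟩
    rw [← aeval_def, aeval_algHom_apply, aeval_X_left_apply, hσg]
  have hint : Algebra.IsIntegral R (A ⧸ 𝔫) := by
    refine ⟨fun y ↦ ?_⟩
    obtain ⟨a, rfl⟩ := Ideal.Quotient.mk_surjective y
    obtain ⟨n, h, hh⟩ := exists_toLaurentSubalgebra_eq_pow_mul hA a
    obtain ⟨α, β, hαβ⟩ := hg.isCoprime_X.pow_right (n := n)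
    have h1 : Ideal.Quotient.mk 𝔫 a = σ (β * h) := by
      have h2 := congrArg σ hαβ
      have h3 : σ h = σ X ^ n * Ideal.Quotient.mk 𝔫 a := by
        rw [← map_pow]
        exact (congrArg (Ideal.Quotient.mk 𝔫) hh).trans (by simp [σ, π])
      simp only [map_add, map_mul, hσg, mul_zero, zero_add, map_one, map_pow] at h2
      rw [map_mul, h3, ← mul_assoc, h2, one_mul]
    rw [h1, ← aeval_X_left_apply (β * h), ← aeval_algHom_apply]
    exact .of_mem_of_fg _ hX.fg_adjoin_singleton _ (aeval_mem_adjoin_singleton R _)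
  have hfield : (⊥ : Ideal (A ⧸ 𝔫)).IsMaximal := by
    let := Ideal.Quotient.field 𝔫
    exact Ideal.bot_isMaximal
  have hcomap : (⊥ : Ideal (A ⧸ 𝔫)).comap (algebraMap R (A ⧸ 𝔫)) = IsLocalRing.maximalIdeal R :=
    IsLocalRing.eq_maximalIdeal (Ideal.isMaximal_comap_of_isIntegral_of_isMaximal
      (R := R) (S := A ⧸ 𝔫) ⊥)
  have hμ' : μ ∈ 𝔫 := by
    refine Ideal.map_le_iff_le_comap.2 (fun r hr ↦ ?_) hμ
    rw [← hcomap] at hr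
    exact (Ideal.Quotient.eq_zero_iff_mem (I := 𝔫)).1 hr
  have hX' : π X ∈ 𝔫 :=
    hprime.mem_of_pow_mem l ((Ideal.add_mem_iff_left _ hμ').1 (hle hJ))
  obtain ⟨α, β, hαβ⟩ := hg.isCoprime_X
  refine hmax.ne_top ((Ideal.eq_top_iff_one _).2 ?_)
  rw [← map_one π, ← hαβ, map_add, map_mul, map_mul]
  exact add_mem (Ideal.mul_mem_left _ _ (hle hgJ)) (Ideal.mul_mem_left _ _ hX')

end Subalgebra

section Localization

variable {A : Type*} [CommRing A]

theorem exists_pow_smul_mem_range_mkLinearMap (F : A) {M : Type*} [AddCommGroup M] [Module A M]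
    (z : LocalizedModule (Submonoid.powers F) M) :
    ∃ n : ℕ, F ^ n • z ∈ LinearMap.range (LocalizedModule.mkLinearMap (Submonoid.powers F) M) := by
  obtain ⟨⟨m, ⟨_, n, rfl⟩⟩, hm⟩ := IsLocalizedModule.surj (Submonoid.powers F)
    (LocalizedModule.mkLinearMap (Submonoid.powers F) M) z
  exact ⟨n, m, hm.symm⟩

theorem exists_comp_eq_pow_smul {P Q : Type*} [AddCommGroup P] [Module A P] [Module.Finite A P]
    [Module.Projective A P] [AddCommGroup Q] [Module A Q] [Module.Finite A Q]
    [Module.Projective A Q] {F : A}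
    {ι : LocalizedModule (Submonoid.powers F) Q →ₗ[Localization (Submonoid.powers F)]
      LocalizedModule (Submonoid.powers F) P}
    {ρ : LocalizedModule (Submonoid.powers F) P →ₗ[Localization (Submonoid.powers F)]
      LocalizedModule (Submonoid.powers F) Q} (h : ρ ∘ₗ ι = LinearMap.id) :
    ∃ (n : ℕ) (φ : Q →ₗ[A] P) (ψ : P →ₗ[A] Q), ψ ∘ₗ φ = F ^ n • LinearMap.id := by
  let S := Submonoid.powers F
  obtain ⟨a, φ, hφ⟩ := exists_lift_pow_smul F (LocalizedModule.mkLinearMap S P)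
    (exists_pow_smul_mem_range_mkLinearMap F)
    (ι.restrictScalars A ∘ₗ LocalizedModule.mkLinearMap S Q)
  obtain ⟨b, ψ, hψ⟩ := exists_lift_pow_smul F (LocalizedModule.mkLinearMap S Q)
    (exists_pow_smul_mem_range_mkLinearMap F)
    (ρ.restrictScalars A ∘ₗ LocalizedModule.mkLinearMap S P)
  have hzero (z : Q) : LocalizedModule.mkLinearMap S Q (ψ (φ z)) =
      LocalizedModule.mkLinearMap S Q (F ^ (b + a) • z) := by
    have h1 := LinearMap.congr_fun h (LocalizedModule.mkLinearMap S Q z)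
    simp only [LinearMap.comp_apply, LinearMap.id_apply] at h1
    rw [hψ, LinearMap.comp_apply, hφ, map_smul, map_smul, LinearMap.comp_apply,
      LinearMap.restrictScalars_apply, LinearMap.restrictScalars_apply, h1, pow_add, mul_smul]
  obtain ⟨c, hc⟩ := exists_pow_smul_mem_of_finite F (ψ ∘ₗ φ - F ^ (b + a) • LinearMap.id) ⊥ <| by
    intro z
    obtain ⟨⟨_, n, rfl⟩, hn⟩ := IsLocalizedModule.exists_of_eq (S := S) (hzero z)
    exact ⟨n, by simpa [smul_sub, sub_eq_zero, Submonoid.smul_def] using hn⟩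
  refine ⟨c + (b + a), φ, F ^ c • ψ, ?_⟩
  ext z
  have := hc z
  rw [Submodule.mem_bot, LinearMap.sub_apply, smul_sub, sub_eq_zero] at this
  simpa [pow_add, mul_smul] using this

end Localization

section Residue

variable {R : Type*} [CommRing R] [IsLocalRing R] (A : Subalgebra R (LaurentPolynomial R))

/-- Reduction of Laurent polynomials in `A` modulo the maximal ideal of `R`. -/
noncomputable def laurentResidue : A →+* LaurentPolynomial (IsLocalRing.ResidueField R) :=
  (AddMonoidAlgebra.mapRingHom ℤ (IsLocalRing.residue R)).comp A.val.toRingHom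

variable {A} (hA : ∀ p : R[X], p.toLaurent ∈ A)

theorem laurentResidue_toLaurentSubalgebra (p : R[X]) :
    laurentResidue A (toLaurentSubalgebra hA p) = toLaurent (p.map (IsLocalRing.residue R)) :=
  LaurentPolynomial.mapRingHom_toLaurent _ p

theorem exists_pow_mul_mem_range_laurentResidue
    (c : LaurentPolynomial (IsLocalRing.ResidueField R)) :
    ∃ n : ℕ, laurentResidue A (toLaurentSubalgebra hA X ^ n) * c ∈ (laurentResidue A).range := by
  obtain ⟨n, h, hh⟩ := c.exists_T_pow
  obtain ⟨p, rfl⟩ := map_surjective _ IsLocalRing.residue_surjective h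
  refine ⟨n, toLaurentSubalgebra hA p, ?_⟩
  rw [laurentResidue_toLaurentSubalgebra, hh, map_pow, laurentResidue_toLaurentSubalgebra, map_X,
    ← map_pow, toLaurent_X_pow, mul_comm]

theorem exists_pow_mul_mem_map_maximalIdeal {a : A} (ha : laurentResidue A a = 0) :
    ∃ n : ℕ, toLaurentSubalgebra hA X ^ n * a ∈
      (IsLocalRing.maximalIdeal R).map (algebraMap R A) := by
  obtain ⟨n, h, hh⟩ := exists_toLaurentSubalgebra_eq_pow_mul hA a
  refine ⟨n, ?_⟩
  have h0 : h.map (IsLocalRing.residue R) = 0 := by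
    rw [← toLaurent_eq_zero, ← laurentResidue_toLaurentSubalgebra hA, hh, map_mul, ha, mul_zero]
  have hmem : h ∈ (IsLocalRing.maximalIdeal R).map (C : R →+* R[X]) := by
    refine Ideal.mem_map_C_iff.2 fun i ↦ ?_
    rw [← IsLocalRing.residue_eq_zero_iff, ← coeff_map, h0, coeff_zero]
  rw [← hh]
  have hcomp : (toLaurentSubalgebra hA).toRingHom.comp (C : R →+* R[X]) = algebraMap R A :=
    (toLaurentSubalgebra hA).comp_algebraMap
  rw [← hcomp, ← Ideal.map_map]
  exact Ideal.mem_map_of_mem _ hmem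

end Residue

/-- Roy–Mandal type theorem: let `(R,𝔪)` be a commutative Noetherian local ring and
`A` a ring with `R[X] ⊆ A ⊆ R[X,X⁻¹]`.  Let `P`, `Q` be finitely generated projective
`A`-modules of constant ranks `q < p`.  If `Q_f` is a direct summand of `P_f` for some
special monic `f ∈ R[X]`, then `Q` is a direct summand of `P`. -/
theorem direct_summand_of_special_monic_localization
    (R : Type) [CommRing R] [IsNoetherianRing R] [IsLocalRing R]
    (A : Subalgebra R (LaurentPolynomial R))
    (hA : ∀ p : R[X], p.toLaurent ∈ A)
    (P Q : Type) [AddCommGroup P] [Module A P] [Module.Finite A P] [Module.Projective A P]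
    [AddCommGroup Q] [Module A Q] [Module.Finite A Q] [Module.Projective A Q]
    (p q : ℕ) (hP : HasConstRank A P p) (hQ : HasConstRank A Q q) (hrank : q < p)
    (f : R[X]) (hf : IsSpecialMonic f)
    (hsummand : ∃ (ι : LocalizedModule (Submonoid.powers (⟨f.toLaurent, hA f⟩ : A)) Q
          →ₗ[Localization (Submonoid.powers (⟨f.toLaurent, hA f⟩ : A))]
        LocalizedModule (Submonoid.powers (⟨f.toLaurent, hA f⟩ : A)) P)
      (ρ : LocalizedModule (Submonoid.powers (⟨f.toLaurent, hA f⟩ : A)) P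
          →ₗ[Localization (Submonoid.powers (⟨f.toLaurent, hA f⟩ : A))]
        LocalizedModule (Submonoid.powers (⟨f.toLaurent, hA f⟩ : A)) Q),
      ρ ∘ₗ ι = LinearMap.id) :
    ∃ (ι : Q →ₗ[A] P) (ρ : P →ₗ[A] Q), ρ ∘ₗ ι = LinearMap.id := by
  obtain ⟨ι, ρ, hρι⟩ := hsummand
  obtain ⟨n, φ, ψ₀, hψ₀⟩ := exists_comp_eq_pow_smul hρι
  let π := toLaurentSubalgebra hA
  set f₁ : R[X] := (X + 1) * f ^ n
  have hf₁ : IsSpecialMonic f₁ := isSpecialMonic_X_add_one.mul (hf.pow n)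
  have hdeg : 0 < f₁.natDegree := by
    have h1 : (X + 1 : R[X]).natDegree = 1 := natDegree_X_add_C 1
    rw [isSpecialMonic_X_add_one.1.natDegree_mul (hf.pow n).1, h1]
    omega
  let ψ := π (X + 1) • ψ₀
  have hψφ : ψ ∘ₗ φ = π f₁ • LinearMap.id := by
    have h1 : π f = ⟨f.toLaurent, hA f⟩ := rfl
    rw [LinearMap.smul_comp, hψ₀, ← h1, ← map_pow, smul_smul, ← map_mul]
  let k := IsLocalRing.ResidueField R
  let _ : Algebra A (LaurentPolynomial k) := (laurentResidue A).toAlgebra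
  have hpid := LaurentPolynomial.isPrincipalIdealRing k
  have hrank' : Module.finrank (LaurentPolynomial k) (LaurentPolynomial k ⊗[A] Q) <
      Module.finrank (LaurentPolynomial k) (LaurentPolynomial k ⊗[A] P) := by
    rw [finrank_tensorProduct_of_rankAtStalk_eq (M := P) (n := p) (funext fun 𝔭 ↦ hP 𝔭.asIdeal),
      finrank_tensorProduct_of_rankAtStalk_eq (M := Q) (n := q) (funext fun 𝔭 ↦ hQ 𝔭.asIdeal)]
    exact hrank
  have hunit : IsUnit (laurentResidue A (π X)) := by
    rw [laurentResidue_toLaurentSubalgebra, map_X, toLaurent_X]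
    exact LaurentPolynomial.isUnit_T 1
  have hne : laurentResidue A (π f₁) ≠ 0 := by
    rw [laurentResidue_toLaurentSubalgebra, toLaurent_ne_zero]
    exact (hf₁.1.map _).ne_zero
  obtain ⟨θ, hθ⟩ := exists_forall_comp_eq_pow_add_smul (K := LaurentPolynomial k) (x := π X)
    (I := (IsLocalRing.maximalIdeal R).map (algebraMap R A)) hunit
    (fun c ↦ exists_pow_mul_mem_range_laurentResidue hA c)
    (fun a ha ↦ exists_pow_mul_mem_map_maximalIdeal hA ha) hrank' hne hψφ
  obtain ⟨χ, hmonic, hχ⟩ := LinearMap.exists_monic_and_aeval_eq_zero A (-(ψ ∘ₗ θ))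
  obtain ⟨m, N, g, hg, hgeval⟩ := exists_isSpecialMonic_eval_scaleRoots hf₁ hdeg
    (hmonic.map A.val.toRingHom)
  replace hgeval : (χ.scaleRoots (π X ^ m)).eval (π f₁ ^ (N + 1)) = π g := by
    refine Subtype.ext (Eq.trans ?_ hgeval)
    have h1 : (χ.map A.val.toRingHom).scaleRoots (toLaurent X ^ m) =
        (χ.scaleRoots (π X ^ m)).map A.val.toRingHom := by
      rw [map_scaleRoots _ _ _ (by simp [hmonic.leadingCoeff])]
      rfl
    rw [h1]
    exact (eval_map_apply A.val.toRingHom (π f₁ ^ (N + 1))).symm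
  let φ' : Q →ₗ[A] P := π f₁ ^ N • φ + π X ^ m • θ
  let J : Ideal A :=
    { carrier := {a | ∃ ρ : P →ₗ[A] Q, ρ ∘ₗ φ' = a • LinearMap.id}
      zero_mem' := ⟨0, by simp⟩
      add_mem' := by
        rintro a b ⟨ρ, hρ⟩ ⟨σ, hσ⟩
        exact ⟨ρ + σ, by rw [LinearMap.add_comp, hρ, hσ, add_smul]⟩
      smul_mem' := by
        rintro c a ⟨ρ, hρ⟩
        exact ⟨c • ρ, by rw [LinearMap.smul_comp, hρ, smul_smul, smul_eq_mul]⟩ }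
  have hgJ : π g ∈ J := by
    obtain ⟨V, hV⟩ := exists_mul_sub_eq_algebraMap_eval
      (scaleRoots_aeval_eq_zero (r := π X ^ m) hχ) (π f₁ ^ (N + 1))
    rw [hgeval] at hV
    refine ⟨V ∘ₗ ψ, ?_⟩
    ext z
    have h1 : ψ (φ z) = π f₁ • z := LinearMap.congr_fun hψφ z
    have h2 := LinearMap.congr_fun hV z
    rw [mul_neg, sub_neg_eq_add, Module.End.mul_apply, LinearMap.add_apply,
      Module.End.mul_apply, Module.algebraMap_end_apply, Module.algebraMap_end_apply] at h2
    simpa [φ', h1, smul_smul, pow_succ] using h2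
  obtain ⟨l, μ, ρ', hμ, hρ'⟩ := hθ (π f₁ ^ N) m
  have htop : J = ⊤ := eq_top_of_isSpecialMonic_mem hA hg hgJ hμ ⟨ρ', hρ'⟩
  obtain ⟨r, hr⟩ := (Ideal.eq_top_iff_one J).1 htop
  exact ⟨φ', r, by rw [hr, one_smul]⟩
end

section
/- Let R be a commutative Noetherian local ring and A a ring with R[X] ⊆ A ⊆ R[X, X⁻¹]. Let P be a finitely generated projective A-module such that P_f is free for some special monic polynomial f ∈ R[X]. Then P is a free A-module. -/
set_option synthInstance.maxHeartbeats 1000000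
set_option maxHeartbeats 1000000

open Polynomial

section

variable {R : Type*} [CommRing R] {n : ℕ}

/-- Vectors of polynomials whose `i`-th entry has degree less than `d i`. -/
noncomputable def degreeLTPi (R : Type*) [CommRing R] {n : ℕ} (d : Fin n → ℕ) :
    Submodule R (Fin n → R[X]) :=
  Submodule.pi Set.univ fun i => degreeLT R (d i)

theorem mem_degreeLTPi {d : Fin n → ℕ} {x : Fin n → R[X]} :
    x ∈ degreeLTPi R d ↔ ∀ i j, d i ≤ j → (x i).coeff j = 0 := by
  simp only [degreeLTPi, Submodule.mem_pi, Set.mem_univ, true_imp_iff, mem_degreeLT,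
    degree_lt_iff_coeff_zero]

theorem degreeLTPi_fg (d : Fin n → ℕ) : (degreeLTPi R d).FG := by
  refine Submodule.fg_pi fun i => ?_
  classical
  rw [degreeLT_eq_span_X_pow]
  exact Submodule.fg_span (Finset.finite_toSet _)

theorem single_mem_degreeLTPi {d : Fin n → ℕ} {i : Fin n} {p : R[X]}
    (hp : ∀ j, d i ≤ j → p.coeff j = 0) : Pi.single i p ∈ degreeLTPi R d := by
  rw [mem_degreeLTPi]
  intro l j hj
  rcases eq_or_ne l i with rfl | hl
  · simpa using hp j hj
  · simp [hl]

/-- If each `X ^ d i` times a basis vector is congruent modulo `M` to a vector of entries of degree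
less than `d`, then so is every vector. -/
theorem restrictScalars_sup_degreeLTPi_eq_top (M : Submodule R[X] (Fin n → R[X])) (d : Fin n → ℕ)
    (h : ∀ i, (Pi.single i (X ^ d i) : Fin n → R[X]) ∈ M.restrictScalars R ⊔ degreeLTPi R d) :
    M.restrictScalars R ⊔ degreeLTPi R d = ⊤ := by
  set V := M.restrictScalars R ⊔ degreeLTPi R d with hV
  have hT : degreeLTPi R d ≤ V := le_sup_right
  have hX : ∀ x ∈ V, (X : R[X]) • x ∈ V := by
    intro x hx
    obtain ⟨a, ha, t, ht, rfl⟩ := Submodule.mem_sup.1 hx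
    rw [smul_add]
    refine V.add_mem (le_sup_left (a := M.restrictScalars R) (M.smul_mem X ha)) ?_
    rw [← Finset.univ_sum_single ((X : R[X]) • t)]
    refine V.sum_mem fun i _ => ?_
    rw [mem_degreeLTPi] at ht
    have hsplit : (Pi.single i (((X : R[X]) • t) i) : Fin n → R[X]) =
        (Pi.single i (X * t i - C ((X * t i).coeff (d i)) * X ^ d i) : Fin n → R[X]) +
          (X * t i).coeff (d i) • (Pi.single i (X ^ d i) : Fin n → R[X]) := by
      rw [← Pi.single_smul, ← Pi.single_add, smul_eq_C_mul, sub_add_cancel, Pi.smul_apply,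
        smul_eq_mul]
    rw [hsplit]
    refine V.add_mem (hT (single_mem_degreeLTPi fun j hj => ?_)) (V.smul_mem _ (h i))
    rcases hj.eq_or_lt with rfl | hj
    · simp
    · obtain ⟨j, rfl⟩ : ∃ k, j = k + 1 := ⟨j - 1, by omega⟩
      rw [coeff_sub, coeff_X_mul, coeff_C_mul, coeff_X_pow, if_neg (by omega),
        ht i j (by omega)]
      simp
  have hp : ∀ (p : R[X]), ∀ x ∈ V, p • x ∈ V := by
    intro p x hx
    induction p using Polynomial.induction_on' with
    | add p q hp hq => rw [add_smul]; exact V.add_mem hp hq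
    | monomial k a =>
      induction k with
      | zero =>
        have : (monomial 0 a : R[X]) • x = a • x := by
          ext i : 1
          simp [smul_eq_C_mul]
        rw [this]
        exact V.smul_mem _ hx
      | succ k ih =>
        have := hX _ ih
        rwa [smul_smul, X_mul_monomial] at this
  rw [eq_top_iff]
  intro x _
  rw [← Finset.univ_sum_single x]
  refine V.sum_mem fun i _ => ?_
  have h1 : (Pi.single i 1 : Fin n → R[X]) ∈ V := by
    rcases Nat.eq_zero_or_pos (d i) with h0 | h0
    · simpa [h0] using h i
    · refine hT (single_mem_degreeLTPi fun j hj => ?_)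
      rw [coeff_one, if_neg (by omega)]
  have := hp (x i) _ h1
  rwa [← Pi.single_smul, smul_eq_mul, mul_one] at this

open IsLocalRing in
/-- A form of Horrocks' theorem over a Noetherian local ring: a submodule of `R[X]ⁿ` that contains
a monic multiple of `R[X]ⁿ`, and whose reduction modulo the maximal ideal embeds in that of
`R[X]ⁿ`, is generated by `n` elements. -/
theorem exists_span_range_eq_of_monic_smul_mem [IsNoetherianRing R] [IsLocalRing R]
    (M : Submodule R[X] (Fin n → R[X])) (g : R[X]) (hg : g.Monic) (hgM : ∀ x, g • x ∈ M)
    (hM : ∀ x ∈ M, (∀ i, x i ∈ (maximalIdeal R).map C) → x ∈ (maximalIdeal R).map C • M) :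
    ∃ w : Fin n → Fin n → R[X], Submodule.span R[X] (Set.range w) = M := by
  have hjac : maximalIdeal R ≤ Ideal.jacobson ⊥ := IsLocalRing.maximalIdeal_le_jacobson _
  set U : Submodule R[X] (Fin n → R[X]) :=
    Submodule.pi Set.univ fun _ => (maximalIdeal R).map C with hU
  have memU : ∀ x, x ∈ U ↔ ∀ i, x i ∈ (maximalIdeal R).map C := fun x => by
    simp [hU, Submodule.mem_pi]
  have U_le : U.restrictScalars R ≤
      maximalIdeal R • (⊤ : Submodule R (Fin n → R[X])) := by
    have : (⊤ : Submodule R (Fin n → R[X])) =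
      (⊤ : Submodule R[X] (Fin n → R[X])).restrictScalars R := rfl
    rw [this, ← Ideal.smul_restrictScalars]
    intro x hx
    change x ∈ (maximalIdeal R).map C • (⊤ : Submodule R[X] (Fin n → R[X]))
    rw [← Finset.univ_sum_single x]
    refine Submodule.sum_mem _ fun i _ => ?_
    have := Submodule.smul_mem_smul ((memU x).1 hx i)
      (Submodule.mem_top (x := (Pi.single i 1 : Fin n → R[X])))
    rwa [← Pi.single_smul, smul_eq_mul, mul_one] at this
  let good : Set (Fin n → ℕ) := {d | ∀ x ∈ degreeLTPi R d, x ∈ M ⊔ U → x ∈ U}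
  have hsingle : ∀ i, (Pi.single i g : Fin n → R[X]) ∈ M := fun i => by
    have := hgM (Pi.single i 1)
    rwa [← Pi.single_smul, smul_eq_mul, mul_one] at this
  have hfin : good.Finite := by
    refine (Set.finite_Iic (fun _ : Fin n => g.natDegree)).subset fun d hd i => ?_
    by_contra! hlt
    have h1 := hd (Pi.single i g)
      (single_mem_degreeLTPi fun j hj => coeff_eq_zero_of_natDegree_lt (hlt.trans_le hj))
      (Submodule.mem_sup_left (hsingle i))
    have h2 := (memU _).1 h1 i
    rw [Pi.single_eq_same, Ideal.mem_map_C_iff] at h2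
    have h3 := h2 g.natDegree
    rw [hg.coeff_natDegree] at h3
    exact (Ideal.ne_top_iff_one _).1 (maximalIdeal.isMaximal R).ne_top h3
  have hne : good.Nonempty := ⟨0, fun x hx _ => by
    have : x = 0 := by
      ext i j
      exact mem_degreeLTPi.1 hx i j (Nat.zero_le _)
    rw [this]
    exact U.zero_mem⟩
  obtain ⟨d, hd, hmax⟩ := hfin.exists_maximal hne
  set T := degreeLTPi R d with hT
  have hX : ∀ i, (Pi.single i (X ^ d i) : Fin n → R[X]) ∈ (M ⊔ U).restrictScalars R ⊔ T := by
    intro i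
    have hnot : Function.update d i (d i + 1) ∉ good := fun hmem => by
      have hle : d ≤ Function.update d i (d i + 1) := by
        rw [le_update_iff]; simp
      have := hmax hmem hle i
      simp at this
    simp only [good, Set.mem_ofPred_eq, not_forall] at hnot
    obtain ⟨x, hx, hxM, hxU⟩ := hnot
    rw [mem_degreeLTPi] at hx
    set r := (x i).coeff (d i) with hr
    set s : Fin n → R[X] := Pi.single i (X ^ d i) with hs
    have hrs : ∀ l j, ((r • s) l).coeff j = if l = i ∧ j = d i then r else 0 := by
      intro l j
      rcases eq_or_ne l i with rfl | hl
      · simp [s, coeff_X_pow]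
      · simp [s, hl]
    have ht : x - r • s ∈ T := by
      rw [hT, mem_degreeLTPi]
      intro l j hj
      rw [Pi.sub_apply, coeff_sub, hrs]
      rcases eq_or_ne l i with rfl | hl
      · rcases hj.eq_or_lt with rfl | hj
        · simp [hr]
        · rw [hx l j (by simpa using hj), if_neg (by omega), sub_zero]
      · rw [hx l j (by simpa [hl] using hj), if_neg (by simp [hl]), sub_zero]
    by_cases hrm : r ∈ maximalIdeal R
    · have hrU : r • s ∈ U := by
        rw [memU]
        intro l
        rw [Ideal.mem_map_C_iff]
        intro j
        rw [hrs]
        split_ifs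
        · exact hrm
        · exact Submodule.zero_mem _
      have := hd _ ht (Submodule.sub_mem _ hxM (Submodule.mem_sup_right hrU))
      exact absurd (by simpa using U.add_mem this hrU) hxU
    · have hunit : IsUnit r := by simpa using hrm
      obtain ⟨u, hu⟩ := hunit
      have hrV : r • s ∈ (M ⊔ U).restrictScalars R ⊔ T := by
        have := Submodule.sub_mem _ (Submodule.mem_sup_left (T := T)
          (S := (M ⊔ U).restrictScalars R) hxM) (Submodule.mem_sup_right ht)
        rwa [sub_sub_cancel] at this
      have := Submodule.smul_mem _ (↑u⁻¹ : R) hrV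
      rwa [smul_smul, ← hu, Units.inv_mul, one_smul] at this
  have hMUT := restrictScalars_sup_degreeLTPi_eq_top _ d hX
  set T' := degreeLTPi R (fun _ : Fin n => g.natDegree) with hT'
  have hMT' : M.restrictScalars R ⊔ T' = ⊤ := by
    refine restrictScalars_sup_degreeLTPi_eq_top _ _ fun i => ?_
    have : (Pi.single i (X ^ g.natDegree) : Fin n → R[X]) =
        Pi.single i g - Pi.single i (g - X ^ g.natDegree) := by
      rw [← Pi.single_sub, sub_sub_cancel]
    rw [this]
    refine Submodule.sub_mem _ (Submodule.mem_sup_left (hsingle i))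
      (Submodule.mem_sup_right (single_mem_degreeLTPi fun j hj => ?_))
    rcases hj.eq_or_lt with rfl | hj
    · simp [hg.coeff_natDegree]
    · rw [coeff_sub, coeff_X_pow, if_neg hj.ne', coeff_eq_zero_of_natDegree_lt hj, sub_zero]
  have hMT : M.restrictScalars R ⊔ T = ⊤ := by
    have h1 : T' ≤ (M.restrictScalars R ⊔ T) ⊔ maximalIdeal R • T' := by
      have h2 : U.restrictScalars R ≤
          M.restrictScalars R ⊔ maximalIdeal R • T' := by
        refine U_le.trans ?_
        rw [← hMT', Submodule.smul_sup]
        exact sup_le_sup_right Submodule.smul_le_right _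
      refine le_top.trans ?_
      rw [← hMUT]
      refine sup_le ?_ (le_sup_right.trans le_sup_left)
      intro x hx
      obtain ⟨a, ha, b, hb, rfl⟩ := Submodule.mem_sup.1 ((Submodule.restrictScalars_mem ..).1 hx)
      refine Submodule.add_mem _ (Submodule.mem_sup_left (Submodule.mem_sup_left ha)) ?_
      exact sup_le_sup_right (le_sup_left (b := T)) (maximalIdeal R • T') (h2 hb)
    have h3 := Submodule.le_of_le_smul_of_le_jacobson_bot (degreeLTPi_fg _) hjac h1
    rw [eq_top_iff, ← hMT']
    exact sup_le le_sup_left h3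
  have hw : ∀ i, ∃ w ∈ M, (Pi.single i (X ^ d i) : Fin n → R[X]) - w ∈ T := fun i => by
    obtain ⟨a, ha, t, ht, hat⟩ := Submodule.mem_sup.1
      (hMT ▸ Submodule.mem_top : (Pi.single i (X ^ d i) : Fin n → R[X]) ∈ M.restrictScalars R ⊔ T)
    exact ⟨a, ha, by rwa [← hat, add_sub_cancel_left]⟩
  choose w hwM hwT using hw
  refine ⟨w, le_antisymm (Submodule.span_le.2 (by rintro _ ⟨i, rfl⟩; exact hwM i)) ?_⟩
  set W := Submodule.span R[X] (Set.range w) with hW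
  have hWM : W ≤ M := Submodule.span_le.2 (by rintro _ ⟨i, rfl⟩; exact hwM i)
  have hWT : W.restrictScalars R ⊔ T = ⊤ := by
    refine restrictScalars_sup_degreeLTPi_eq_top _ _ fun i => ?_
    have := Submodule.add_mem _ (Submodule.mem_sup_left (T := T) (S := W.restrictScalars R)
      (Submodule.subset_span ⟨i, rfl⟩ : w i ∈ W)) (Submodule.mem_sup_right (hwT i))
    rwa [add_sub_cancel] at this
  have hMW : M.restrictScalars R ≤ W.restrictScalars R ⊔ (M.restrictScalars R ⊓ T) := by
    intro x hx
    obtain ⟨a, ha, t, ht, rfl⟩ := Submodule.mem_sup.1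
      (hWT ▸ Submodule.mem_top : x ∈ W.restrictScalars R ⊔ T)
    refine Submodule.add_mem _ (Submodule.mem_sup_left ha) (Submodule.mem_sup_right ⟨?_, ht⟩)
    have := M.sub_mem hx (hWM ha)
    rwa [add_sub_cancel_left] at this
  have hfg : (M.restrictScalars R ⊓ T).FG :=
     (degreeLTPi_fg d).of_le inf_le_right
  have hMTM : M.restrictScalars R ⊓ T ≤ maximalIdeal R • M.restrictScalars R := by
    rintro x ⟨hxM, hxT⟩
    have h1 := hM x hxM ((memU x).1 (hd x hxT (Submodule.mem_sup_left hxM)))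
    rw [← Ideal.smul_restrictScalars]
    exact h1
  have h4 : M.restrictScalars R ⊓ T ≤
      W.restrictScalars R ⊔ maximalIdeal R • (M.restrictScalars R ⊓ T) := by
    refine hMTM.trans ((smul_mono_right _ hMW).trans ?_)
    rw [Submodule.smul_sup]
    exact sup_le_sup_right Submodule.smul_le_right _
  have h5 := Submodule.le_of_le_smul_of_le_jacobson_bot hfg hjac h4
  exact hMW.trans (sup_le le_rfl h5)

theorem isCoprime_X_pow_of_coeff_zero_eq_one {g : R[X]} (hg : g.coeff 0 = 1) (k : ℕ) :
    IsCoprime (X ^ k) g := by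
  refine IsCoprime.pow_left ⟨-g.divX, 1, ?_⟩
  have := g.divX_mul_X_add
  rw [hg, C_1] at this
  rw [one_mul]
  nth_rewrite 2 [← this]
  ring

/-- Multiplication by a monic polynomial is injective modulo an ideal of coefficients. -/
theorem mem_map_C_of_monic_mul_mem {I : Ideal R} {g p : R[X]} (hg : g.Monic)
    (h : g * p ∈ I.map C) : p ∈ I.map C := by
  rw [← Ideal.mk_ker (I := I), ← ker_mapRingHom, RingHom.mem_ker, coe_mapRingHom] at h ⊢
  rw [Polynomial.map_mul] at h
  exact (hg.map _).isRegular.left.eq_iff.1 (h.trans (mul_zero _).symm)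

/-- Finitely many elements have a common denominator. -/
theorem exists_common_pow {A : Type*} [CommRing A] (ι : R[X] →+* A)
    (hι : ∀ a, ∃ k p, ι p = ι X ^ k * a) {s : Type*} [Fintype s] (a : s → A) :
    ∃ (k : ℕ) (p : s → R[X]), ∀ i, ι (p i) = ι X ^ k * a i := by
  choose k p hp using fun i => hι (a i)
  refine ⟨∑ i, k i, fun i => X ^ (∑ j, k j - k i) * p i, fun i => ?_⟩
  rw [map_mul, map_pow, hp, ← mul_assoc, ← pow_add,
    Nat.sub_add_cancel (Finset.single_le_sum (fun _ _ => Nat.zero_le _) (Finset.mem_univ i))]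

/-- A monic polynomial with constant term `1` is not a zero divisor in `A`. -/
theorem eq_zero_of_mul_eq_zero_of_monic {A : Type*} [CommRing A] (ι : R[X] →+* A)
    (hinj : Function.Injective ι) (hι : ∀ a, ∃ k p, ι p = ι X ^ k * a) {g : R[X]}
    (hg : g.Monic) (hg0 : g.coeff 0 = 1) (a : A) (ha : ι g * a = 0) : a = 0 := by
  obtain ⟨k, p, hp⟩ := hι a
  obtain ⟨u, v, huv⟩ := isCoprime_X_pow_of_coeff_zero_eq_one hg0 k
  have h1 : p = 0 := by
    refine hg.isRegular.left.eq_iff.1 (hinj ?_)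
    simp only [mul_zero, map_mul, map_zero]
    rw [hp]
    linear_combination (ι X ^ k) * ha
  have := congrArg ι huv
  simp only [map_add, map_mul, map_one, map_pow] at this
  rw [h1, map_zero] at hp
  linear_combination (-a) * this - ι u * hp + ι v * ha

/-- Descent of Horrocks' theorem along `R[X] → A`, where every element of `A` has a power of `X`
as a denominator: a finite projective module containing linearly independent elements
that span it after inverting a monic polynomial with constant term `1` is free. -/
theorem free_of_linearIndependent_of_smul_mem_span [IsNoetherianRing R] [IsLocalRing R]
    {A : Type*} [CommRing A] (ι : R[X] →+* A) (hinj : Function.Injective ι)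
    (hι : ∀ a, ∃ k p, ι p = ι X ^ k * a)
    {P : Type*} [AddCommGroup P] [Module A P] [Module.Finite A P] [Module.Projective A P]
    (g : R[X]) (hg : g.Monic) (hg0 : g.coeff 0 = 1)
    (e : Fin n → P) (he : LinearIndependent A e)
    (hge : ∀ p, ι g • p ∈ Submodule.span A (Set.range e)) : Module.Free A P := by
  let b := Module.Basis.span he
  let θ : P →ₗ[A] (Fin n → A) := b.equivFun.toLinearMap ∘ₗ
    LinearMap.codRestrict _ (LinearMap.lsmul A P (ι g)) hge
  have hθ : ∀ p, ∑ i, θ p i • e i = ι g • p := by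
    intro p
    have := congrArg Subtype.val (b.sum_equivFun
      (LinearMap.codRestrict _ (LinearMap.lsmul A P (ι g)) hge p))
    simp only [Submodule.coe_sum, Submodule.coe_smul, b, Module.Basis.span_apply] at this
    exact this
  have hcop : ∀ k, ∃ u v : R[X], u * X ^ k + v * g = 1 :=
    isCoprime_X_pow_of_coeff_zero_eq_one hg0
  have hdiv : ∀ a : A, ∃ p c, a = ι p + ι g * c := by
    intro a
    obtain ⟨k, p, hp⟩ := hι a
    obtain ⟨u, v, huv⟩ := hcop k
    refine ⟨u * p, ι v * a, ?_⟩
    have := congrArg ι huv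
    simp only [map_add, map_mul, map_one, map_pow] at this
    rw [map_mul, hp]
    linear_combination (-a) * this
  have hreg := eq_zero_of_mul_eq_zero_of_monic ι hinj hι hg hg0
  obtain ⟨r, π, hπ⟩ := Module.Finite.exists_fin' A P
  obtain ⟨σ, hσ⟩ := Module.projective_lifting_property π LinearMap.id hπ
  have hσ' : ∀ p, π (σ p) = p := fun p => LinearMap.congr_fun hσ p
  have hregP : ∀ p : P, ι g • p = 0 → p = 0 := by
    intro p hp
    have : σ p = 0 := by
      ext j
      refine hreg _ ?_
      have := congrFun (congrArg σ hp) j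
      simpa using this
    rw [← hσ' p, this, map_zero]
  have hθe : ∀ y : Fin n → A, θ (∑ i, y i • e i) = ι g • y := by
    intro y
    have h1 := hθ (∑ i, y i • e i)
    rw [Finset.smul_sum] at h1
    simp only [smul_smul] at h1
    rw [← sub_eq_zero, ← Finset.sum_sub_distrib] at h1
    simp only [← sub_smul] at h1
    have h2 := Fintype.linearIndependent_iff.1 he _ h1
    ext i
    simpa using sub_eq_zero.1 (h2 i)
  have hθinj : Function.Injective θ := by
    rw [injective_iff_map_eq_zero]
    intro p hp
    refine hregP p ?_
    rw [← hθ, hp]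
    simp
  let vec (x : Fin n → R[X]) : Fin n → A := fun i => ι (x i)
  let M : Submodule R[X] (Fin n → R[X]) :=
    { carrier := {x | ∃ p, θ p = vec x}
      add_mem' := by
        rintro x y ⟨p, hp⟩ ⟨q, hq⟩
        exact ⟨p + q, by ext i; simp [hp, hq, vec]⟩
      zero_mem' := ⟨0, by ext i; simp [vec]⟩
      smul_mem' := by
        rintro c x ⟨p, hp⟩
        exact ⟨ι c • p, by ext i; simp [hp, vec]⟩ }
  have memM : ∀ x, x ∈ M ↔ ∃ p, θ p = vec x := fun x => Iff.rfl
  have hgM : ∀ x, g • x ∈ M := fun x =>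
    ⟨∑ i, vec x i • e i, by rw [hθe]; ext i; simp [vec]⟩
  obtain ⟨w, hw⟩ := exists_span_range_eq_of_monic_smul_mem M g hg hgM (by
    intro x hxM hx
    obtain ⟨p, hp⟩ := (memM x).1 hxM
    set I := (IsLocalRing.maximalIdeal R).map C with hI
    obtain ⟨k₁, y, hy⟩ := exists_common_pow ι hι (fun ij : Fin n × Fin r => σ (e ij.1) ij.2)
    obtain ⟨k₂, q, hq⟩ := exists_common_pow ι hι (σ p)
    have hqI : ∀ j, q j ∈ I := by
      intro j
      refine mem_map_C_of_monic_mul_mem (hg.mul (monic_X_pow k₁)) ?_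
      have : g * X ^ k₁ * q j = X ^ k₂ * ∑ i, x i * y (i, j) := by
        apply hinj
        have h1 := congrFun (congrArg σ (hθ p)) j
        simp only [hp, map_sum, map_smul, Finset.sum_apply, Pi.smul_apply, smul_eq_mul, vec] at h1
        simp only [map_mul, map_pow, map_sum, hq, hy]
        have h2 : ∑ i, ι (x i) * (ι X ^ k₁ * σ (e i) j) = ι X ^ k₁ * (ι g * σ p j) := by
          rw [← h1, Finset.mul_sum]
          exact Finset.sum_congr rfl fun i _ => by ring
        rw [h2]
        ring
      rw [this]
      exact I.mul_mem_left _ (I.sum_mem fun i _ => I.mul_mem_right _ (hx i))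
    obtain ⟨k₃, z, hz⟩ := exists_common_pow ι hι
      (fun ji : Fin r × Fin n => θ (π (Pi.single ji.1 1)) ji.2)
    have hzM : ∀ j, (fun i => z (j, i)) ∈ M := fun j =>
      ⟨ι X ^ k₃ • π (Pi.single j 1), by ext i; simp [vec, hz]⟩
    have hXx : (X ^ (k₂ + k₃) : R[X]) • x = ∑ j, q j • fun i => z (j, i) := by
      ext1 i
      apply hinj
      have h1 : p = ∑ j, σ p j • π (Pi.single j 1) := by
        conv_lhs => rw [← hσ' p, ← Finset.univ_sum_single (σ p)]
        rw [map_sum]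
        refine Finset.sum_congr rfl fun j _ => ?_
        rw [← map_smul, ← Pi.single_smul, smul_eq_mul, mul_one]
      have h2 : ι (x i) = ∑ j, σ p j * θ (π (Pi.single j 1)) i := by
        have h3 := congrFun hp i
        rw [h1, map_sum] at h3
        simpa [vec] using h3.symm
      simp only [Pi.smul_apply, smul_eq_mul, map_mul, map_pow, Finset.sum_apply, map_sum, hq, hz,
        h2, Finset.mul_sum]
      exact Finset.sum_congr rfl fun j _ => by ring
    have hXM : (X ^ (k₂ + k₃) : R[X]) • x ∈ I • M := by
      rw [hXx]
      exact Submodule.sum_mem _ fun j _ => Submodule.smul_mem_smul (hqI j) (hzM j)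
    have hgx : g • x ∈ I • M := by
      have : g • x = ∑ i, x i • g • (Pi.single i 1 : Fin n → R[X]) := by
        conv_lhs => rw [← Finset.univ_sum_single x]
        rw [Finset.smul_sum]
        refine Finset.sum_congr rfl fun i _ => ?_
        have h1 : (Pi.single i (x i) : Fin n → R[X]) = x i • Pi.single i 1 := by
          rw [← Pi.single_smul, smul_eq_mul, mul_one]
        rw [h1, smul_comm]
      rw [this]
      exact Submodule.sum_mem _ fun i _ => Submodule.smul_mem_smul (hx i) (hgM _)
    obtain ⟨u, v, huv⟩ := hcop (k₂ + k₃)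
    rw [← one_smul R[X] x, ← huv, add_smul, mul_smul, mul_smul]
    exact Submodule.add_mem _ (Submodule.smul_mem _ u hXM) (Submodule.smul_mem _ v hgx))
  have hwM : ∀ i, w i ∈ M := fun i => hw ▸ Submodule.subset_span ⟨i, rfl⟩
  choose c hc using fun i => (memM _).1 (hwM i)
  have hM : ∀ p, (∃ x, θ p = vec x) → p ∈ Submodule.span A (Set.range c) := by
    rintro p ⟨x, hx⟩
    have hxM : x ∈ M := ⟨p, hx⟩
    rw [← hw, Submodule.mem_span_range_iff_exists_fun] at hxM
    obtain ⟨a, ha⟩ := hxM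
    rw [Submodule.mem_span_range_iff_exists_fun]
    refine ⟨fun i => ι (a i), hθinj ?_⟩
    rw [hx, ← ha]
    ext i
    simp [vec, hc]
  have hspan : ⊤ ≤ Submodule.span A (Set.range c) := by
    intro p _
    choose x y hxy using fun i => hdiv (θ p i)
    have he_mem : ∀ i, e i ∈ Submodule.span A (Set.range c) := fun i => hM _
      ⟨g • Pi.single i 1, by
        have := hθe (Pi.single i 1)
        simp only [Pi.single_apply, ite_smul, one_smul, zero_smul, Finset.sum_ite_eq',
          Finset.mem_univ, if_true] at this
        rw [this]
        ext l
        rcases eq_or_ne l i with rfl | hl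
        · simp [vec]
        · simp [vec, hl]⟩
    have h1 : p - ∑ i, y i • e i ∈ Submodule.span A (Set.range c) := by
      refine hM _ ⟨x, ?_⟩
      rw [map_sub, hθe]
      ext i
      simp [vec, hxy]
    have := Submodule.add_mem _ h1 (Submodule.sum_mem _ (t := Finset.univ)
      fun i _ => Submodule.smul_mem _ (y i) (he_mem i))
    rwa [sub_add_cancel] at this
  have hli : LinearIndependent A c := by
    have h1 : Function.Surjective (Fintype.linearCombination A c) := by
      rw [← LinearMap.range_eq_top, Fintype.range_linearCombination]
      exact top_le_iff.1 hspan
    have h2 : Function.Injective (Fintype.linearCombination A e) :=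
      linearIndependent_iff_injective_fintypeLinearCombination.1 he
    exact linearIndependent_iff_injective_fintypeLinearCombination.2
      (OrzechProperty.injective_of_surjective_of_injective _ _ h2 h1)
  exact Module.Free.of_basis (Module.Basis.mk hli hspan)

/-- A basis of `P_f` can be chosen in `P`, with a uniform power of `f` as denominator. -/
theorem exists_linearIndependent_of_free_localizedModule {A : Type*} [CommRing A]
    {P : Type*} [AddCommGroup P] [Module A P] [Module.Finite A P] (f : A)
    (hf : ∀ a, f * a = 0 → a = 0)
    (hfree : Module.Free (Localization (Submonoid.powers f))
      (LocalizedModule (Submonoid.powers f) P)) :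
    ∃ (n : ℕ) (e : Fin n → P) (N : ℕ), LinearIndependent A e ∧
      ∀ p, f ^ N • p ∈ Submodule.span A (Set.range e) := by
  set S := Submonoid.powers f with hS
  let φ := LocalizedModule.mkLinearMap S P
  let b := Module.Free.chooseBasis (Localization S) (LocalizedModule S P)
  have hbe : ∀ i, ∃ (p : P) (s : S), (s : A) • b i = φ p := fun i => by
    obtain ⟨⟨p, s⟩, h⟩ := IsLocalizedModule.surj S φ (b i)
    exact ⟨p, s, h⟩
  choose e s hes using hbe
  have hS0 : ∀ (t : S) (a : A), (t : A) * a = 0 → a = 0 := by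
    rintro ⟨_, k, rfl⟩ a ha
    induction k with
    | zero => simpa using ha
    | succ k ih =>
      simp only [pow_succ', mul_assoc] at ha
      exact ih (hf _ ha)
  have hinj : Function.Injective fun a : A => a • (1 : Localization S) := by
    have : S ≤ nonZeroDivisors A := fun t ht => by
      rw [mem_nonZeroDivisors_iff_left]
      exact hS0 ⟨t, ht⟩
    simpa only [Algebra.smul_def, mul_one] using IsLocalization.injective (Localization S) this
  have he : LinearIndependent A e := by
    rw [Fintype.linearIndependent_iff]
    intro a ha i
    have h1 := congrArg φ ha
    simp only [map_sum, map_smul, ← hes, map_zero, smul_smul] at h1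
    have h2 := Fintype.linearIndependent_iff.1 (b.linearIndependent.restrict_scalars hinj) _ h1 i
    exact hS0 (s i) _ (by rwa [mul_comm])
  have hmem : ∀ z : LocalizedModule S P,
      ∃ (t : S), ∃ q ∈ Submodule.span A (Set.range e), (t : A) • z = φ q := by
    intro z
    have hz : z ∈ Submodule.span (Localization S) (Set.range b) := by
      rw [b.span_eq]; trivial
    induction hz using Submodule.span_induction with
    | mem x hx =>
      obtain ⟨i, rfl⟩ := hx
      exact ⟨s i, e i, Submodule.subset_span ⟨i, rfl⟩, hes i⟩
    | zero => exact ⟨1, 0, Submodule.zero_mem _, by simp⟩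
    | add x y _ _ hx hy =>
      obtain ⟨t, q, hq, h⟩ := hx
      obtain ⟨t', q', hq', h'⟩ := hy
      refine ⟨t * t', (t' : A) • q + (t : A) • q',
        Submodule.add_mem _ (Submodule.smul_mem _ _ hq) (Submodule.smul_mem _ _ hq'), ?_⟩
      rw [map_add, map_smul, map_smul, ← h, ← h', smul_smul, smul_smul, smul_add, Submonoid.coe_mul,
        mul_comm (t' : A)]
    | smul c x _ hx =>
      obtain ⟨t, q, hq, h⟩ := hx
      obtain ⟨⟨a, u⟩, hc⟩ := IsLocalization.surj S c
      refine ⟨u * t, a • q, Submodule.smul_mem _ _ hq, ?_⟩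
      rw [map_smul, ← h, Submonoid.coe_mul, mul_smul, smul_comm (t : A) c x, smul_comm a,
        ← algebraMap_smul (Localization S) (u : A), smul_smul, mul_comm, hc,
        algebraMap_smul, smul_comm]
  have hpow : ∀ p, ∃ k, f ^ k • p ∈ Submodule.span A (Set.range e) := by
    intro p
    obtain ⟨t, q, hq, h⟩ := hmem (φ p)
    rw [← map_smul] at h
    obtain ⟨u, hu⟩ := (IsLocalizedModule.eq_iff_exists S φ).1 h
    obtain ⟨k, hk⟩ := (u * t).2
    refine ⟨k, ?_⟩
    have hu' : (u : A) • (t : A) • p = (u : A) • q := hu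
    have hk' : f ^ k = (u : A) * t := hk
    rw [hk', mul_smul, hu']
    exact Submodule.smul_mem _ _ hq
  obtain ⟨r, π, hπ⟩ := Module.Finite.exists_fin' A P
  choose k hk using fun j : Fin r => hpow (π (Pi.single j 1))
  let ε := Fintype.equivFin (Module.Free.ChooseBasisIndex (Localization S) (LocalizedModule S P))
  refine ⟨_, e ∘ ε.symm, ∑ j, k j, he.comp _ ε.symm.injective, fun p => ?_⟩
  rw [ε.symm.surjective.range_comp]
  obtain ⟨v, rfl⟩ := hπ p
  rw [← Finset.univ_sum_single v, map_sum, Finset.smul_sum]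
  refine Submodule.sum_mem _ fun j _ => ?_
  have h1 : (Pi.single j (v j) : Fin r → A) = v j • Pi.single j 1 := by
    rw [← Pi.single_smul, smul_eq_mul, mul_one]
  rw [h1, map_smul, smul_comm, ← Nat.sub_add_cancel
    (Finset.single_le_sum (f := k) (fun _ _ => Nat.zero_le _) (Finset.mem_univ j)), pow_add,
    mul_smul]
  exact Submodule.smul_mem _ _ (Submodule.smul_mem _ _ (hk j))

end

/-- Let `R` be a commutative Noetherian local ring and `A` a ring with
`R[X] ⊆ A ⊆ R[X,X⁻¹]`.  If `P` is a finitely generated projective `A`-module such that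
`P_f` is free for some special monic `f ∈ R[X]`, then `P` is free. -/
theorem free_of_special_monic_localization_free
    (R : Type) [CommRing R] [IsNoetherianRing R] [IsLocalRing R]
    (A : Subalgebra R (LaurentPolynomial R))
    (hA : ∀ p : R[X], p.toLaurent ∈ A)
    (P : Type) [AddCommGroup P] [Module A P] [Module.Finite A P] [Module.Projective A P]
    (f : R[X]) (hf : IsSpecialMonic f)
    (hfree : Module.Free (Localization (Submonoid.powers (⟨f.toLaurent, hA f⟩ : A)))
      (LocalizedModule (Submonoid.powers (⟨f.toLaurent, hA f⟩ : A)) P)) :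
    Module.Free A P := by
  let ι : R[X] →+* A := toLaurent.codRestrict A.toSubring hA
  have hinj : Function.Injective ι := fun p q h =>
    toLaurent_injective (congrArg Subtype.val h)
  have hι : ∀ a, ∃ k p, ι p = ι X ^ k * a := by
    intro a
    obtain ⟨k, p, hp⟩ := LaurentPolynomial.exists_T_pow (a : LaurentPolynomial R)
    refine ⟨k, p, Subtype.ext ?_⟩
    change toLaurent p = toLaurent X ^ k * (a : LaurentPolynomial R)
    rw [hp, mul_comm, toLaurent_X, LaurentPolynomial.T_pow, mul_one]
  obtain ⟨n, e, N, he, hN⟩ := exists_linearIndependent_of_free_localizedModule (ι f)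
    (eq_zero_of_mul_eq_zero_of_monic ι hinj hι hf.1 hf.2) hfree
  refine free_of_linearIndependent_of_smul_mem_span ι hinj hι (f ^ N) (hf.1.pow N) ?_ e he ?_
  · rw [coeff_zero_eq_eval_zero, eval_pow, ← coeff_zero_eq_eval_zero, hf.2, one_pow]
  · simpa only [map_pow] using hN
end

section
/- Let A be a commutative Noetherian ring and P a finitely generated projective A-module of constant rank n. For any pair (α, a) ∈ P* × A, there exists β ∈ P* such that, setting I = (α + aβ)(P), the ideal I·A_a has height at least n in A_a. In particular, if the ideal (α(P), a) of A has height ≥ n, then ht(I) ≥ n, and if moreover I is a proper ideal of A, then ht(I) = n. -/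
/-- The height of an ideal: the infimum of the heights of primes containing it. -/
noncomputable def idealHeight {A : Type*} [CommRing A] (I : Ideal A) : ℕ∞ :=
  ⨅ p : {p : PrimeSpectrum A // I ≤ p.asIdeal}, Order.height p.1

section LinearAlgebra

variable {K V μ : Type*} [Field K] [AddCommGroup V] [Module K V]

open Submodule Module

lemma span_insert_range_add_smul (w : μ → V) (l : V) (c : μ → K) :
    span K (insert l (Set.range fun i ↦ w i + c i • l)) = span K (insert l (Set.range w)) := by
  apply le_antisymm <;> rw [span_le, Set.insert_subset_iff] <;>
    refine ⟨subset_span (Set.mem_insert _ _), ?_⟩ <;> rintro _ ⟨i, rfl⟩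
  · exact add_mem (subset_span (Set.mem_insert_of_mem _ ⟨i, rfl⟩))
      (smul_mem _ _ (subset_span (Set.mem_insert _ _)))
  · have h : w i = (w i + c i • l) - c i • l := by abel
    rw [h]
    exact sub_mem (subset_span (Set.mem_insert_of_mem _ ⟨i, rfl⟩))
      (smul_mem _ _ (subset_span (Set.mem_insert _ _)))

lemma finrank_span_insert_le [FiniteDimensional K V] (s : Set V) (l : V) :
    finrank K (span K (insert l s)) ≤ finrank K (span K s) + 1 := by
  rw [span_insert, add_comm]
  refine (finrank_add_le_finrank_add_finrank _ _).trans (Nat.add_le_add_right ?_ _)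
  exact (finrank_span_le_card ({l} : Set V)).trans (by simp)

lemma exists_forall_mem_span_range_add_smul [Fintype μ] (w : μ → V) (l : V)
    (h : finrank K (span K (insert l (Set.range w))) ≤ Fintype.card μ)
    (hl : l ∉ span K (Set.range w)) :
    ∃ j, ∀ t : μ → K, t j ≠ 0 → (∀ i ≠ j, t i = 0) →
      l ∈ span K (Set.range fun i ↦ w i + t i • l) := by
  have hw : ¬ LinearIndependent K w := by
    intro hw
    have h' := finrank_span_eq_card (linearIndependent_option'.mpr ⟨hw, hl⟩)
    have hr : (Set.range fun o : Option μ ↦ o.casesOn' l w) = insert l (Set.range w) := by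
      ext x
      simp [Option.exists, eq_comm]
    rw [hr, Fintype.card_option] at h'
    omega
  obtain ⟨g, hg, j, hj⟩ := Fintype.not_linearIndependent_iff.mp hw
  refine ⟨j, fun t htj ht ↦ ?_⟩
  have hsum : ∑ i, g i • (w i + t i • l) = (g j * t j) • l := by
    simp only [smul_add, Finset.sum_add_distrib, hg, zero_add, smul_smul]
    rw [Finset.sum_eq_single j]
    · intro i _ hi
      simp [ht i hi]
    · simp
  rw [← smul_mem_iff _ (mul_ne_zero hj htj), ← hsum]
  exact sum_mem fun i _ ↦ smul_mem _ _ (subset_span ⟨i, rfl⟩)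

end LinearAlgebra

namespace Matrix

variable {K m n : Type*} [Field K]

lemma exists_linearIndependent_row_submatrix [Finite m] [Fintype n] (M : Matrix m n K) {r : ℕ}
    (hr : r ≤ M.rank) : ∃ f : Fin r → m, LinearIndependent K (M.submatrix f id).row := by
  rw [rank_eq_finrank_span_row] at hr
  obtain ⟨v, hv, -, hli⟩ := Submodule.exists_fun_fin_finrank_span_eq K (Set.range M.row)
  choose f hf using hv
  refine ⟨f ∘ Fin.castLE hr, ?_⟩
  have hrow : (M.submatrix (f ∘ Fin.castLE hr) id).row = v ∘ Fin.castLE hr :=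
    funext fun i ↦ hf (Fin.castLE hr i)
  rw [hrow]
  exact hli.comp _ (Fin.castLE_injective hr)

lemma exists_det_submatrix_ne_zero [Finite m] [Fintype n] (M : Matrix m n K) {r : ℕ}
    (hr : r ≤ M.rank) : ∃ (f : Fin r → m) (g : Fin r → n), (M.submatrix f g).det ≠ 0 := by
  obtain ⟨f, hf⟩ := M.exists_linearIndependent_row_submatrix hr
  have hrank : (M.submatrix f id)ᵀ.rank = r := by
    rw [rank_transpose, hf.rank_matrix, Fintype.card_fin]
  obtain ⟨g, hg⟩ := (M.submatrix f id)ᵀ.exists_linearIndependent_row_submatrix hrank.ge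
  refine ⟨f, g, ?_⟩
  rw [← det_transpose]
  exact ((Matrix.isUnit_iff_isUnit_det _).mp (linearIndependent_rows_iff_isUnit.mp hg)).ne_zero

end Matrix

section FiberRank

variable {A : Type*} [CommRing A] {ι μ : Type*}

/-- The reduction of a vector modulo a prime ideal, with entries in the residue field. -/
noncomputable def residueVec (p : Ideal A) [p.IsPrime] : (ι → A) →ₗ[A] (ι → p.ResidueField) :=
  (Algebra.linearMap A p.ResidueField).compLeft ι

@[simp]
lemma residueVec_apply (p : Ideal A) [p.IsPrime] (v : ι → A) (i : ι) :
    residueVec p v i = algebraMap A p.ResidueField (v i) := rfl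

lemma residueVec_smul (p : Ideal A) [p.IsPrime] (t : A) (v : ι → A) :
    residueVec p (t • v) = algebraMap A p.ResidueField t • residueVec p v := by
  rw [map_smul, algebraMap_smul]

lemma residueVec_add_smul (p : Ideal A) [p.IsPrime] (w : μ → ι → A) (l : ι → A) (c : μ → A) :
    (fun i ↦ residueVec p (w i + c i • l)) =
      fun i ↦ residueVec p (w i) + algebraMap A p.ResidueField (c i) • residueVec p l := by
  ext1 i
  rw [map_add, residueVec_smul]

/-- The span over the residue field of the reductions of a family of vectors. -/
noncomputable def fiberSpan (p : Ideal A) [p.IsPrime] (W : μ → ι → A) :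
    Submodule p.ResidueField (ι → p.ResidueField) :=
  Submodule.span p.ResidueField (Set.range fun i ↦ residueVec p (W i))

/-- The rank of a family of vectors modulo a prime ideal. -/
noncomputable def fiberRank (p : Ideal A) [p.IsPrime] (W : μ → ι → A) : ℕ :=
  Module.finrank p.ResidueField (fiberSpan p W)

lemma fiberRank_eq_rank_map [Finite μ] [Fintype ι] (p : Ideal A) [p.IsPrime] (W : μ → ι → A) :
    fiberRank p W = ((Matrix.of W).map (algebraMap A p.ResidueField)).rank :=
  (Matrix.rank_eq_finrank_span_row _).symm

lemma exists_ideal_le_iff_fiberRank_le [Finite μ] [Fintype ι] (W : μ → ι → A) (r : ℕ) :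
    ∃ J : Ideal A, ∀ (p : Ideal A) [p.IsPrime], J ≤ p ↔ fiberRank p W ≤ r := by
  refine ⟨Ideal.span (Set.range fun fg : (Fin (r + 1) → μ) × (Fin (r + 1) → ι) ↦
    ((Matrix.of W).submatrix fg.1 fg.2).det), fun p _ ↦ ?_⟩
  have hdet (f : Fin (r + 1) → μ) (g : Fin (r + 1) → ι) :
      ((Matrix.of W).submatrix f g).det ∈ p ↔
        (((Matrix.of W).map (algebraMap A p.ResidueField)).submatrix f g).det = 0 := by
    rw [← Ideal.algebraMap_residueField_eq_zero, RingHom.map_det]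
    rfl
  rw [fiberRank_eq_rank_map, Ideal.span_le, Set.range_subset_iff]
  constructor
  · intro h
    by_contra! hlt
    obtain ⟨f, g, hfg⟩ := Matrix.exists_det_submatrix_ne_zero _ (Nat.succ_le_of_lt hlt)
    exact hfg ((hdet f g).mp (h (f, g)))
  · rintro h ⟨f, g⟩
    by_contra hfg
    have h1 := Matrix.rank_of_det_ne_zero (mt (hdet f g).mpr hfg)
    have h2 := Matrix.rank_submatrix_le ((Matrix.of W).map (algebraMap A p.ResidueField)) f g
    rw [Fintype.card_fin] at h1
    omega

lemma exists_forall_residueVec_mem_fiberSpan [Fintype μ]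
    (w : μ → ι → A) (l : ι → A) (d : μ → A) (S : Finset (PrimeSpectrum A))
    (hd : ∀ p ∈ S, ∀ i, d i ∉ p.asIdeal)
    (hdep : ∀ p ∈ S, Module.finrank p.asIdeal.ResidueField (Submodule.span p.asIdeal.ResidueField
      (insert (residueVec p.asIdeal l) (Set.range fun i ↦ residueVec p.asIdeal (w i)))) ≤
        Fintype.card μ) :
    ∃ c : μ → A, ∀ p ∈ S,
      residueVec p.asIdeal l ∈ fiberSpan p.asIdeal fun i ↦ w i + (d i * c i) • l := by
  classical
  induction S using Finset.strongInduction with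
  | H S ih =>
  obtain rfl | hS := S.eq_empty_or_nonempty
  · simp
  obtain ⟨p, hp⟩ := S.exists_minimal hS
  obtain ⟨c, hc⟩ := ih (S.erase p) (Finset.erase_ssubset hp.prop)
    (fun q hq ↦ hd q (Finset.mem_of_mem_erase hq)) (fun q hq ↦ hdep q (Finset.mem_of_mem_erase hq))
  by_cases hcp : residueVec p.asIdeal l ∈ fiberSpan p.asIdeal fun i ↦ w i + (d i * c i) • l
  · refine ⟨c, fun q hq ↦ ?_⟩
    obtain rfl | hne := eq_or_ne q p
    · exact hcp
    · exact hc q (Finset.mem_erase.mpr ⟨hne, hq⟩)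
  have hprod : ¬ ∏ q ∈ S.erase p, q.asIdeal ≤ p.asIdeal := by
    rw [p.isPrime.prod_le]
    rintro ⟨q, hq, hqp⟩
    rw [Finset.mem_erase] at hq
    exact hq.1 (le_antisymm hqp (hp.le_of_le hq.2 hqp))
  obtain ⟨t, ht, htp⟩ := SetLike.not_le_iff_exists.mp hprod
  obtain ⟨j, hj⟩ := exists_forall_mem_span_range_add_smul
    (fun i ↦ residueVec p.asIdeal (w i + (d i * c i) • l)) (residueVec p.asIdeal l)
    (by
      rw [residueVec_add_smul, span_insert_range_add_smul]
      exact hdep p hp.prop) hcp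
  refine ⟨fun i ↦ c i + if i = j then t else 0, fun q hq ↦ ?_⟩
  obtain rfl | hne := eq_or_ne q p
  · have hfun : (fun i ↦ residueVec q.asIdeal (w i + (d i * (c i + if i = j then t else 0)) • l)) =
        fun i ↦ residueVec q.asIdeal (w i + (d i * c i) • l) +
          algebraMap A q.asIdeal.ResidueField (d i * if i = j then t else 0) •
            residueVec q.asIdeal l := by
      ext1 i
      rw [← residueVec_smul, ← map_add, mul_add, add_smul, add_assoc]
    rw [fiberSpan, hfun]
    refine hj (fun i ↦ algebraMap A _ (d i * if i = j then t else 0)) ?_ ?_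
    · rw [if_pos rfl, Ne, Ideal.algebraMap_residueField_eq_zero]
      exact q.isPrime.mul_notMem (hd q hq j) htp
    · intro i hi
      simp [hi]
  · have hqe := Finset.mem_erase.mpr ⟨hne, hq⟩
    have htq : algebraMap A q.asIdeal.ResidueField t = 0 := by
      rw [Ideal.algebraMap_residueField_eq_zero]
      exact (Ideal.prod_le_inf.trans (Finset.inf_le hqe)) ht
    have h := hc q hqe
    rw [fiberSpan, residueVec_add_smul] at h ⊢
    convert h using 6 with i
    dsimp only
    split_ifs <;> simp [htq]

lemma fiberSpan_insert_add_smul (p : Ideal A) [p.IsPrime] (w : μ → ι → A) (l : ι → A) (c : μ → A) :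
    Submodule.span p.ResidueField (insert (residueVec p l)
      (Set.range fun i ↦ residueVec p (w i + c i • l))) =
    Submodule.span p.ResidueField (insert (residueVec p l)
      (Set.range fun i ↦ residueVec p (w i))) := by
  rw [residueVec_add_smul, span_insert_range_add_smul]

lemma fiberSpan_eq_span_insert (p : Ideal A) [p.IsPrime] {k : ℕ} (W : Fin (k + 1) → ι → A) :
    fiberSpan p W = Submodule.span p.ResidueField (insert (residueVec p (W (Fin.last k)))
      (Set.range fun i : Fin k ↦ residueVec p (W i.castSucc))) := by
  rw [fiberSpan]
  congr 1
  ext x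
  simp [Fin.exists_fin_succ', or_comm, eq_comm]

/-- Adding suitable multiples of the last vector to the others, one may discard it and still
keep the bound on the heights of the primes modulo which the family degenerates. -/
lemma exists_add_smul_last_le_height_add [IsNoetherianRing A] [Fintype ι] (a : A) (n k : ℕ)
    (d : Fin (k + 1) → A) (hd : ∀ (p : Ideal A) [p.IsPrime], a ∉ p → ∀ i, d i ∉ p)
    (W : Fin (k + 2) → ι → A)
    (hW : ∀ (p : Ideal A) [p.IsPrime], a ∉ p → ∀ r ≤ k + 1, fiberRank p W ≤ r →
      (n : ℕ∞) ≤ p.height + r) :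
    ∃ c : Fin (k + 1) → A, ∀ (p : Ideal A) [p.IsPrime], a ∉ p → ∀ r ≤ k,
      fiberRank p (fun i : Fin (k + 1) ↦ W i.castSucc + (d i * c i) • W (Fin.last _)) ≤ r →
      (n : ℕ∞) ≤ p.height + r := by
  classical
  choose J hJ using fun r ↦ exists_ideal_le_iff_fiberRank_le W r
  have hfin : {p : PrimeSpectrum A | a ∉ p.asIdeal ∧ fiberRank p.asIdeal W ≤ k + 1 ∧
      ∃ r ≤ k, p.asIdeal ∈ (J (r + 1)).minimalPrimes}.Finite := by
    have hU : (⋃ r ∈ Set.Iic k, (J (r + 1)).minimalPrimes).Finite :=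
      (Set.finite_Iic k).biUnion fun r _ ↦ Ideal.finite_minimalPrimes_of_isNoetherianRing A _
    refine (hU.preimage (f := PrimeSpectrum.asIdeal)
      fun p _ q _ h ↦ PrimeSpectrum.ext h).subset ?_
    rintro p ⟨-, -, r, hr, hp⟩
    exact Set.mem_biUnion (Set.mem_Iic.mpr hr) hp
  obtain ⟨c, hc⟩ := exists_forall_residueVec_mem_fiberSpan (fun i : Fin (k + 1) ↦ W i.castSucc)
    (W (Fin.last _)) d hfin.toFinset (fun p hp ↦ hd _ (hfin.mem_toFinset.mp hp).1) (by
      intro p hp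
      rw [← fiberSpan_eq_span_insert, Fintype.card_fin]
      exact (hfin.mem_toFinset.mp hp).2.1)
  refine ⟨c, fun p _ hap r hr hrank ↦ ?_⟩
  have hspan : fiberSpan p W = Submodule.span p.ResidueField
      (insert (residueVec p (W (Fin.last _)))
        (Set.range fun i : Fin (k + 1) ↦
          residueVec p (W i.castSucc + (d i * c i) • W (Fin.last _)))) := by
    rw [fiberSpan_insert_add_smul, fiberSpan_eq_span_insert]
  have hle : fiberRank p W ≤ r + 1 := by
    rw [fiberRank, hspan]
    exact (finrank_span_insert_le _ _).trans (Nat.add_le_add_right hrank 1)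
  by_contra hlt
  have hmin : p ∈ (J (r + 1)).minimalPrimes := by
    refine ⟨⟨inferInstance, (hJ _ p).mpr hle⟩, fun q hq hqp ↦ ?_⟩
    obtain ⟨hqprime, hJq⟩ := hq
    by_contra hpq
    have h1 := hW q (fun h ↦ hap (hqp h)) (r + 1) (by omega) ((hJ _ q).mp hJq)
    have h2 := Ideal.height_add_one_le_of_lt_of_isPrime (lt_of_le_not_ge hqp hpq)
    refine hlt (h1.trans ?_)
    rw [Nat.cast_add, Nat.cast_one, add_comm (r : ℕ∞), ← add_assoc]
    exact add_le_add_left h2 _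
  have hmem := hc ⟨p, inferInstance⟩ (hfin.mem_toFinset.mpr ⟨hap, by simp only; omega, r, hr, hmin⟩)
  refine hlt (hW p hap r (by omega) ?_)
  rwa [fiberRank, hspan, Submodule.span_insert_eq_span hmem]

lemma exists_add_smul_sum_le_height [IsNoetherianRing A] [Fintype ι] (a : A) (n k : ℕ)
    (W : Fin (k + 1) → ι → A)
    (hW : ∀ (p : Ideal A) [p.IsPrime], a ∉ p → ∀ r ≤ k, fiberRank p W ≤ r →
      (n : ℕ∞) ≤ p.height + r) :
    ∃ b : Fin k → A, ∀ (p : Ideal A) [p.IsPrime], a ∉ p →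
      (∀ j, (W 0 + a • ∑ i, b i • W i.succ) j ∈ p) → (n : ℕ∞) ≤ p.height := by
  induction k with
  | zero =>
    refine ⟨0, fun p _ hap h ↦ ?_⟩
    have h0 (i : Fin 1) : residueVec p (W i) = 0 := by
      ext j
      simpa [Subsingleton.elim i 0] using h j
    have hrank : fiberRank p W = 0 := by
      have h1 : fiberSpan p W = ⊥ := by
        rw [fiberSpan, Submodule.span_eq_bot]
        rintro _ ⟨i, rfl⟩
        exact h0 i
      rw [fiberRank, h1, finrank_bot]
    simpa using hW p hap 0 le_rfl hrank.le
  | succ k ih =>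
    obtain ⟨c, hc⟩ := exists_add_smul_last_le_height_add a n k
      (Fin.cons a fun _ ↦ 1) (fun p _ hap i ↦ by
        cases i using Fin.cases with
        | zero => exact hap
        | succ i => exact p.one_notMem) W hW
    obtain ⟨b, hb⟩ := ih _ hc
    refine ⟨Fin.snoc b (c 0 + ∑ i, b i * c i.succ), fun p _ hap h ↦ hb p hap ?_⟩
    have hvec : W 0 + a • ∑ i, (Fin.snoc b (c 0 + ∑ i, b i * c i.succ) : Fin (k + 1) → A) i •
        W i.succ = W 0 + (a * c 0) • W (Fin.last _) +
          a • ∑ i, b i • (W i.succ.castSucc + (1 * c i.succ) • W (Fin.last _)) := by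
      simp only [Fin.sum_univ_castSucc, Fin.snoc_castSucc, Fin.snoc_last, Fin.succ_last,
        Fin.succ_castSucc, smul_add, Finset.sum_add_distrib, add_smul, Finset.sum_smul, smul_smul,
        one_mul, Nat.succ_eq_add_one]
      abel
    rw [hvec] at h
    exact h

end FiberRank

section Projective

variable {A P : Type*} [CommRing A] [AddCommGroup P] [Module A P]

lemma finrank_fiber_le_fiberRank {N : ℕ} (p : Ideal A) [p.IsPrime] (π : (Fin N → A) →ₗ[A] P)
    (s : P →ₗ[A] (Fin N → A)) (h : π ∘ₗ s = LinearMap.id) :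
    Module.finrank p.ResidueField (p.Fiber P) ≤
      fiberRank p fun k j ↦ s (π (Pi.single j 1)) k := by
  have hE : Matrix.of (fun k j ↦ s (π (Pi.single j 1)) k) =
      LinearMap.toMatrix (Pi.basisFun A (Fin N)) (Pi.basisFun A (Fin N)) (s ∘ₗ π) := by
    ext k j
    simp
  have hid : π.baseChange p.ResidueField ∘ₗ s.baseChange p.ResidueField = LinearMap.id := by
    rw [← LinearMap.baseChange_comp, h, LinearMap.baseChange_id]
  have hinj : Function.Injective (s.baseChange p.ResidueField) :=
    Function.LeftInverse.injective (g := π.baseChange p.ResidueField) (LinearMap.congr_fun hid)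
  have hsurj : Function.Surjective (π.baseChange p.ResidueField) :=
    Function.RightInverse.surjective (g := s.baseChange p.ResidueField) (LinearMap.congr_fun hid)
  rw [fiberRank_eq_rank_map, hE, ← LinearMap.toMatrix_baseChange,
    Matrix.rank_eq_finrank_range_toLin _
      (Algebra.TensorProduct.basis p.ResidueField (Pi.basisFun A (Fin N)))
      (Algebra.TensorProduct.basis p.ResidueField (Pi.basisFun A (Fin N))),
    Matrix.toLin_toMatrix, LinearMap.baseChange_comp,
    LinearMap.range_comp_of_range_eq_top _ (LinearMap.range_eq_top.mpr hsurj),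
    LinearMap.finrank_range_of_inj hinj]

variable [IsNoetherianRing A] [Module.Finite A P] [Module.Projective A P]

/-- A functional can be modified by a multiple of `a` so that its order ideal is contained in
no prime of height less than the rank that avoids `a`. -/
lemma exists_forall_le_height_of_range_le (n : ℕ)
    (hrank : ∀ (p : Ideal A) [p.IsPrime],
      Module.finrank (Localization.AtPrime p) (LocalizedModule p.primeCompl P) = n)
    (α : P →ₗ[A] A) (a : A) :
    ∃ β : P →ₗ[A] A, ∀ (p : Ideal A) [p.IsPrime], a ∉ p →
      LinearMap.range (α + a • β) ≤ p → (n : ℕ∞) ≤ p.height := by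
  obtain ⟨N, π, s, -, -, hπs⟩ := Module.Finite.exists_comp_eq_id_of_projective A P
  let W : Fin (N + 1) → Fin N → A :=
    Fin.cons (fun j ↦ α (π (Pi.single j 1))) fun k j ↦ s (π (Pi.single j 1)) k
  have hW (p : Ideal A) [p.IsPrime] : n ≤ fiberRank p W := by
    have hle : fiberRank p (fun (k j : Fin N) ↦ s (π (Pi.single j 1)) k) ≤ fiberRank p W := by
      refine Submodule.finrank_mono (Submodule.span_mono ?_)
      rintro _ ⟨k, rfl⟩
      exact ⟨k.succ, rfl⟩
    refine le_trans ?_ hle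
    rw [← hrank p]
    exact (p.finrank_fiber_eq_rankAtStalk (M := P)).ge.trans (finrank_fiber_le_fiberRank p π s hπs)
  obtain ⟨b, hb⟩ := exists_add_smul_sum_le_height a n N W
    fun p _ _ r _ hr ↦ le_add_left (Nat.cast_le.mpr ((hW p).trans hr))
  refine ⟨∑ k, b k • LinearMap.proj k ∘ₗ s, fun p _ hap hp ↦ hb p hap fun j ↦ ?_⟩
  convert hp ⟨π (Pi.single j 1), rfl⟩ using 1
  simp [W]

lemma height_le_of_mem_minimalPrimes_range (n : ℕ) (γ : P →ₗ[A] A) (p : Ideal A) [p.IsPrime]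
    (hrank : Module.finrank (Localization.AtPrime p) (LocalizedModule p.primeCompl P) = n)
    (hp : p ∈ Ideal.minimalPrimes (LinearMap.range γ)) : p.height ≤ n := by
  let R := Localization.AtPrime p
  let M := LocalizedModule p.primeCompl P
  let mk := LocalizedModule.mkLinearMap p.primeCompl P
  let φ : M →ₗ[R] R :=
    IsLocalizedModule.mapExtendScalars p.primeCompl mk (Algebra.linearMap A R) R γ
  have hφ (x : P) : φ (mk x) = algebraMap A R (γ x) :=
    IsLocalizedModule.map_apply p.primeCompl mk (Algebra.linearMap A R) γ x
  have : Module.Free R M := Module.free_of_flat_of_isLocalRing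
  let b := Module.finBasisOfFinrankEq R M hrank
  have hspan : Ideal.map (algebraMap A R) (LinearMap.range γ) =
      Ideal.span (Set.range fun i ↦ φ (b i)) := by
    have hrange : Ideal.span (Set.range fun i ↦ φ (b i)) = LinearMap.range φ := by
      rw [LinearMap.range_eq_map, ← b.span_eq, Submodule.map_span, ← Set.range_comp]
      rfl
    rw [hrange]
    apply le_antisymm
    · rw [Ideal.map_le_iff_le_comap]
      rintro _ ⟨x, rfl⟩
      exact ⟨mk x, hφ x⟩
    · rintro _ ⟨y, rfl⟩
      obtain ⟨⟨x, t⟩, rfl⟩ := IsLocalizedModule.mk'_surjective p.primeCompl mk y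
      have ht : algebraMap A R t * φ (IsLocalizedModule.mk' mk x t) = algebraMap A R (γ x) := by
        rw [← hφ, ← IsLocalizedModule.mk'_cancel' mk x t, ← smul_eq_mul, algebraMap_smul]
        exact ((φ.restrictScalars A).map_smul _ _).symm
      refine (Ideal.unit_mul_mem_iff_mem _ (IsLocalization.map_units R t)).mp ?_
      rw [Function.uncurry_apply_pair, ht]
      exact Ideal.mem_map_of_mem _ ⟨x, rfl⟩
  rw [← Localization.AtPrime.under_maximalIdeal (I := p)] at hp ⊢
  rw [IsLocalization.height_under p.primeCompl]
  rw [← Set.mem_preimage, ← IsLocalization.minimalPrimes_map p.primeCompl R, hspan] at hp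
  refine (Ideal.height_le_card_of_mem_minimalPrimes_span (Set.finite_range _) hp).trans ?_
  rw [← Set.image_univ]
  exact_mod_cast (Set.ncard_image_le Set.finite_univ).trans (by simp [Set.ncard_univ])

end Projective

lemma le_idealHeight_iff {A : Type*} [CommRing A] {I : Ideal A} {n : ℕ∞} :
    n ≤ idealHeight I ↔ ∀ (p : Ideal A) [p.IsPrime], I ≤ p → n ≤ p.height := by
  simp only [idealHeight, le_iInf_iff, ← PrimeSpectrum.height_eq_orderHeight]
  exact ⟨fun h p _ hp ↦ h ⟨⟨p, inferInstance⟩, hp⟩, fun h p ↦ h p.1.asIdeal p.2⟩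

/-- Eisenbud–Evans, as stated by Plumstead.  Let `A` be a commutative Noetherian ring and
`P` a finitely generated projective `A`-module of constant rank `n`.  For `(α, a) ∈ P* × A`
there is `β ∈ P*` such that, with `I = (α + aβ)(P)`, the ideal `I·A_a` has height `≥ n`;
moreover if `ht(α(P), a) ≥ n` then `ht I ≥ n`, and if in addition `I` is proper then
`ht I = n`. -/
theorem eisenbud_evans
    (A : Type) [CommRing A] [IsNoetherianRing A]
    (P : Type) [AddCommGroup P] [Module A P] [Module.Finite A P] [Module.Projective A P]
    (n : ℕ)
    (hrank : ∀ (𝔭 : Ideal A) [𝔭.IsPrime],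
      Module.finrank (Localization.AtPrime 𝔭) (LocalizedModule 𝔭.primeCompl P) = n)
    (α : P →ₗ[A] A) (a : A) :
    ∃ β : P →ₗ[A] A,
      idealHeight (Ideal.map (algebraMap A (Localization (Submonoid.powers a)))
          (LinearMap.range (α + a • β))) ≥ (n : ℕ∞) ∧
      (idealHeight ((LinearMap.range α : Ideal A) ⊔ Ideal.span {a}) ≥ (n : ℕ∞) →
        idealHeight (LinearMap.range (α + a • β) : Ideal A) ≥ (n : ℕ∞) ∧
        ((LinearMap.range (α + a • β) : Ideal A) ≠ ⊤ →
          idealHeight (LinearMap.range (α + a • β) : Ideal A) = (n : ℕ∞))) := by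
  obtain ⟨β, hβ⟩ := exists_forall_le_height_of_range_le n hrank α a
  refine ⟨β, le_idealHeight_iff.mpr fun q _ hq ↦ ?_, fun h ↦ ?_⟩
  · rw [← IsLocalization.height_under (Submonoid.powers a) q]
    refine hβ _ (fun ha ↦ ?_) (Ideal.map_le_iff_le_comap.mp hq)
    exact Ideal.IsPrime.ne_top' (Ideal.eq_top_of_isUnit_mem q ha
      (IsLocalization.map_units _ (⟨a, Submonoid.mem_powers a⟩ : Submonoid.powers a)))
  · have hle : (n : ℕ∞) ≤ idealHeight (LinearMap.range (α + a • β)) := by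
      refine le_idealHeight_iff.mpr fun p _ hp ↦ ?_
      by_cases ha : a ∈ p
      · refine le_idealHeight_iff.mp h p (sup_le ?_ ((Ideal.span_singleton_le_iff_mem p).mpr ha))
        rintro _ ⟨x, rfl⟩
        have hx : α x = (α + a • β) x - a * β x := by simp
        rw [hx]
        exact p.sub_mem (hp ⟨x, rfl⟩) (p.mul_mem_right _ ha)
      · exact hβ p ha hp
    refine ⟨hle, fun hne ↦ le_antisymm ?_ hle⟩
    obtain ⟨p, hp⟩ := Ideal.nonempty_minimalPrimes hne
    have := hp.isPrime
    exact (le_idealHeight_iff.mp le_rfl p hp.le).trans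
      (height_le_of_mem_minimalPrimes_range n _ p (hrank p) hp)
end
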